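/- arXiv:2310.18128 — 3 statements merged into one kernel-verified Lean document; each statement's English description precedes it below -/
import Mathlib

section
/- For the curves P and Q of the DTW lower-bound construction, there exists an xy-monotone path from vertex (1,1) to vertex (20·n_r, 20·n_c) of the induced vertex-weighted grid whose cost equals DTW(P,Q) and which contains no white boundary vertices. -/
/-- A single step of an xy-monotone path in the grid:
coordinates change by (1,0), (0,1), or (1,1). -/
def MStep (u v : ℕ × ℕ) : Prop :=
  (v.1 = u.1 + 1 ∧ v.2 = u.2) ∨ (v.1 = u.1 ∧ v.2 = u.2 + 1) ∨
    (v.1 = u.1 + 1 ∧ v.2 = u.2 + 1)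

/-- `π` is an xy-monotone path from `s` to `t`. -/
def MPath (π : List (ℕ × ℕ)) (s t : ℕ × ℕ) : Prop :=
  π ≠ [] ∧ π.head? = some s ∧ π.getLast? = some t ∧ π.Chain' MStep

/-- Cost of a path in a vertex-weighted grid: sum of the weights of all its
vertices. -/
noncomputable def vcost (w : ℕ × ℕ → ℝ) (π : List (ℕ × ℕ)) : ℝ :=
  (π.map w).sum

/-- The point `⋆ = −U⁵`. -/
noncomputable def starPt (U : ℕ) : ℝ := -(U : ℝ) ^ 5

/-- The `o`-th point (offsets `0,…,19`) of the 20-point curve `α_i`: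
eight copies of `⋆`, then `α_i¹,…,α_i⁴`, then eight copies of `⋆`. -/
noncomputable def alphaVal (U : ℕ) (r d : ℕ → ℕ) (i o : ℕ) : ℝ :=
  if o = 8 then (U : ℝ) ^ 4 + 2 * (r i) * (U : ℝ) ^ 3 + (d i) / 4
  else if o = 9 then 2 * (U : ℝ) ^ 4 + 2 * (r i) * (U : ℝ) ^ 3 - (d i) / 4
  else if o = 10 then 3 * (U : ℝ) ^ 4 - 2 * (r i) * (U : ℝ) ^ 3 + (d i) / 4
  else if o = 11 then 4 * (U : ℝ) ^ 4 - 2 * (r i) * (U : ℝ) ^ 3 - (d i) / 4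
  else starPt U

/-- The `o`-th point (offsets `0,…,19`) of the 20-point curve `β_j`:
eight copies of `⋆`, then `β_j¹,…,β_j⁴`, then eight copies of `⋆`. -/
noncomputable def betaVal (U : ℕ) (c b : ℕ → ℕ) (j o : ℕ) : ℝ :=
  if o = 8 then (U : ℝ) ^ 4 + 2 * (c j) * (U : ℝ) ^ 3 - U
  else if o = 9 then 2 * (U : ℝ) ^ 4 + 2 * (c j) * (U : ℝ) ^ 3 + U
  else if o = 10 then 3 * (U : ℝ) ^ 4 - 2 * (c j) * (U : ℝ) ^ 3 + (-1 : ℝ) ^ (b j) * U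
  else if o = 11 then 4 * (U : ℝ) ^ 4 - 2 * (c j) * (U : ℝ) ^ 3 - (-1 : ℝ) ^ (b j) * U
  else starPt U

/-- The curve `P` (1-indexed, of length `20·n_r`): concatenation of
`α_0, …, α_{n_r−1}`. -/
noncomputable def Pcur (U : ℕ) (r d : ℕ → ℕ) (k : ℕ) : ℝ :=
  alphaVal U r d ((k - 1) / 20) ((k - 1) % 20)

/-- The curve `Q` (1-indexed, of length `20·n_c`): concatenation of
`β_0, …, β_{n_c−1}`. -/
noncomputable def Qcur (U : ℕ) (c b : ℕ → ℕ) (k : ℕ) : ℝ :=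
  betaVal U c b ((k - 1) / 20) ((k - 1) % 20)

/-- Vertex `(x,y)` is white: exactly one of `p_x`, `q_y` equals `⋆`. -/
noncomputable def White (U : ℕ) (r d c b : ℕ → ℕ) (v : ℕ × ℕ) : Prop :=
  (Pcur U r d v.1 = starPt U ∧ Qcur U c b v.2 ≠ starPt U) ∨
  (Pcur U r d v.1 ≠ starPt U ∧ Qcur U c b v.2 = starPt U)

/-- Vertex `(x,y)` lies in the first or last row or column of its
(20×20) gadget. -/
def GadgetBoundary (v : ℕ × ℕ) : Prop :=
  (v.1 - 1) % 20 = 0 ∨ (v.1 - 1) % 20 = 19 ∨ (v.2 - 1) % 20 = 0 ∨ (v.2 - 1) % 20 = 19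

/-- A monotone walk from `s` to `t`, indexed by its total `w`-weight and total `b`-weight over
all vertices except the initial one. -/
inductive Walk (w : ℕ × ℕ → ℝ) (b : ℕ × ℕ → ℕ) (s : ℕ × ℕ) : ℕ × ℕ → ℝ → ℕ → Prop
  | nil : Walk w b s s 0 0
  | snoc {t u : ℕ × ℕ} {C : ℝ} {B : ℕ} :
      Walk w b s t C B → MStep t u → Walk w b s u (C + w u) (B + b u)

namespace Walk

variable {w : ℕ × ℕ → ℝ} {b : ℕ × ℕ → ℕ} {s t u : ℕ × ℕ} {C C' : ℝ} {B B' : ℕ}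

theorem mono (h : Walk w b s t C B) : s.1 ≤ t.1 ∧ s.2 ≤ t.2 := by
  induction h with
  | nil => exact ⟨le_rfl, le_rfl⟩
  | snoc _ hs ih => unfold MStep at hs; omega

theorem trans (h : Walk w b s t C B) (h' : Walk w b t u C' B') :
    Walk w b s u (C + C') (B + B') := by
  induction h' with
  | nil => simpa using h
  | snoc _ hs ih => simpa [add_assoc] using ih.snoc hs

theorem single (hs : MStep s t) : Walk w b s t (w t) (b t) := by
  simpa using (nil (w := w) (b := b) (s := s)).snoc hs

theorem swap (h : Walk w b s t C B) :
    Walk (fun v => w v.swap) (fun v => b v.swap) s.swap t.swap C B := by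
  induction h with
  | nil => exact nil
  | @snoc t u C B _ hs ih =>
    have hs' : MStep t.swap u.swap := by
      unfold MStep at *; simp only [Prod.fst_swap, Prod.snd_swap]; omega
    simpa using ih.snoc hs'

/-- A walk reaching row `a` from above splits at its first vertex in that row. -/
theorem split_row (h : Walk w b s t C B) {a : ℕ} (hs : s.1 < a) (ht : a ≤ t.1) :
    ∃ f g C₁ B₁ C₂ B₂, Walk w b s f C₁ B₁ ∧ MStep f g ∧ Walk w b g t C₂ B₂ ∧
      f.1 + 1 = a ∧ g.1 = a ∧ C = C₁ + w g + C₂ ∧ B = B₁ + b g + B₂ := by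
  induction h with
  | nil => omega
  | @snoc t u C B hw hst ih =>
    by_cases hat : a ≤ t.1
    · obtain ⟨f, g, C₁, B₁, C₂, B₂, h1, h2, h3, h4, h5, h6, h7⟩ := ih hat
      exact ⟨f, g, C₁, B₁, _, _, h1, h2, h3.snoc hst, h4, h5, by rw [h6]; ring, by rw [h7]; ring⟩
    · refine ⟨t, u, C, B, 0, 0, hw, hst, nil, ?_, ?_, by ring, by ring⟩ <;>
        unfold MStep at hst <;> omega

theorem split_col (h : Walk w b s t C B) {a : ℕ} (hs : s.2 < a) (ht : a ≤ t.2) :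
    ∃ f g C₁ B₁ C₂ B₂, Walk w b s f C₁ B₁ ∧ MStep f g ∧ Walk w b g t C₂ B₂ ∧
      f.2 + 1 = a ∧ g.2 = a ∧ C = C₁ + w g + C₂ ∧ B = B₁ + b g + B₂ := by
  obtain ⟨f, g, C₁, B₁, C₂, B₂, h1, h2, h3, h4, h5, h6, h7⟩ := h.swap.split_row hs ht
  have h1' := h1.swap
  have h3' := h3.swap
  simp only [Prod.swap_swap] at h1' h3'
  refine ⟨f.swap, g.swap, C₁, B₁, C₂, B₂, h1', ?_, h3', h4, h5, h6, h7⟩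
  unfold MStep at *; simp only [Prod.fst_swap, Prod.snd_swap]; omega

theorem exists_of_pos (h : Walk w b s t C B) (hB : 0 < B) :
    ∃ f g C₁ B₁ C₂ B₂, Walk w b s f C₁ B₁ ∧ MStep f g ∧ Walk w b g t C₂ B₂ ∧
      0 < b g ∧ C = C₁ + w g + C₂ ∧ B = B₁ + b g + B₂ := by
  induction h with
  | nil => omega
  | @snoc t u C B hw hst ih =>
    by_cases hu : 0 < b u
    · exact ⟨t, u, C, B, 0, 0, hw, hst, nil, hu, by ring, by ring⟩
    · obtain ⟨f, g, C₁, B₁, C₂, B₂, h1, h2, h3, h5, h6, h7⟩ := ih (by omega)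
      exact ⟨f, g, C₁, B₁, _, _, h1, h2, h3.snoc hst, h5, by rw [h6]; ring, by rw [h7]; ring⟩

/-- A walk meets every column between its endpoints. -/
theorem sum_col_le (h : Walk w b s t C B) (hw : ∀ v, 0 ≤ w v) (f : ℕ → ℝ)
    (hf : ∀ v : ℕ × ℕ, s.1 ≤ v.1 → v.1 ≤ t.1 → s.2 ≤ v.2 → v.2 ≤ t.2 → f v.2 ≤ w v) :
    ∑ y ∈ Finset.Ioc s.2 t.2, f y ≤ C := by
  induction h with
  | nil => simp
  | @snoc t u C B h hst ih =>
    have hm := h.mono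
    have hst' := hst
    unfold MStep at hst'
    have ih' := ih fun v h1 h2 h3 h4 => hf v h1 (by omega) h3 (by omega)
    have hu := hw u
    by_cases hc : u.2 = t.2
    · rw [hc]; linarith
    · have hc' : u.2 = t.2 + 1 := by omega
      have := hf u (by omega) le_rfl (by omega) le_rfl
      rw [hc'] at this ⊢
      rw [Finset.sum_Ioc_succ_top hm.2]
      linarith

/-- A walk meets every row between its endpoints. -/
theorem sum_row_le (h : Walk w b s t C B) (hw : ∀ v, 0 ≤ w v) (f : ℕ → ℝ)
    (hf : ∀ v : ℕ × ℕ, s.1 ≤ v.1 → v.1 ≤ t.1 → s.2 ≤ v.2 → v.2 ≤ t.2 → f v.1 ≤ w v) :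
    ∑ x ∈ Finset.Ioc s.1 t.1, f x ≤ C :=
  h.swap.sum_col_le (fun _ => hw _) f fun v h1 h2 h3 h4 => hf v.swap h3 h4 h1 h2

theorem horizontal (x : ℕ) {y₁ y₂ : ℕ} (h : y₁ ≤ y₂) :
    Walk w b (x, y₁) (x, y₂) (∑ y ∈ Finset.Ioc y₁ y₂, w (x, y))
      (∑ y ∈ Finset.Ioc y₁ y₂, b (x, y)) := by
  induction y₂, h using Nat.le_induction with
  | base => simpa using nil
  | succ n hn ih =>
    rw [Finset.sum_Ioc_succ_top hn, Finset.sum_Ioc_succ_top hn]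
    exact ih.snoc (Or.inr (Or.inl ⟨rfl, rfl⟩))

theorem vertical (y : ℕ) {x₁ x₂ : ℕ} (h : x₁ ≤ x₂) :
    Walk w b (x₁, y) (x₂, y) (∑ x ∈ Finset.Ioc x₁ x₂, w (x, y))
      (∑ x ∈ Finset.Ioc x₁ x₂, b (x, y)) :=
  (horizontal (w := fun v => w v.swap) (b := fun v => b v.swap) y h).swap

theorem finite_weights (w : ℕ × ℕ → ℝ) (b : ℕ × ℕ → ℕ) (s t : ℕ × ℕ) :
    {p : ℝ × ℕ | Walk w b s t p.1 p.2}.Finite := by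
  induction hn : t.1 + t.2 using Nat.strong_induction_on generalizing t with
  | _ n ih =>
    have hpred : {u | MStep u t}.Finite := by
      refine (Set.toFinite {(t.1 - 1, t.2), (t.1, t.2 - 1), (t.1 - 1, t.2 - 1)}).subset ?_
      rintro ⟨x, y⟩ hu
      simp only [Set.mem_ofPred_eq, MStep] at hu
      simp only [Set.mem_insert_iff, Set.mem_singleton_iff, Prod.mk.injEq]
      omega
    have hfin : (⋃ u ∈ {u | MStep u t},
        (fun p : ℝ × ℕ => (p.1 + w t, p.2 + b t)) '' {p : ℝ × ℕ | Walk w b s u p.1 p.2}).Finite := by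
      refine hpred.biUnion fun u hu => (ih (u.1 + u.2) ?_ u rfl).image _
      simp only [Set.mem_ofPred_eq, MStep] at hu
      omega
    refine ((Set.finite_singleton (0, 0)).union hfin).subset ?_
    rintro ⟨C, B⟩ h
    simp only [Set.mem_ofPred_eq] at h
    cases h with
    | nil => exact Or.inl rfl
    | @snoc u _ C B h hst =>
      exact Or.inr (Set.mem_biUnion (x := u) hst ⟨(C, B), h, rfl⟩)

theorem exists_list (h : Walk w b s t C B) :
    ∃ π, MPath π s t ∧ vcost w π = w s + C ∧ (π.map b).sum = b s + B ∧
      ∀ v ∈ π, v.1 ≤ t.1 ∧ v.2 ≤ t.2 := by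
  induction h with
  | nil => exact ⟨[s], ⟨by simp, by simp, by simp, List.isChain_singleton s⟩, by simp [vcost], by simp, by simp⟩
  | @snoc t u C B _ hst ih =>
    obtain ⟨π, ⟨h1, h2, h3, h4⟩, h5, h6, h7⟩ := ih
    refine ⟨π ++ [u], ⟨by simp, ?_, by simp, ?_⟩, ?_, ?_, ?_⟩
    · simp [List.head?_append, h2]
    · refine List.isChain_append.2 ⟨h4, by simp, ?_⟩
      intro x hx y hy
      rw [h3] at hx
      simp only [Option.mem_def, Option.some.injEq, List.head?_cons] at hx hy
      exact hx ▸ hy ▸ hst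
    · simp only [vcost] at h5 ⊢
      simp [h5, add_assoc]
    · simp [h6, add_assoc]
    · intro v hv
      unfold MStep at hst
      rcases List.mem_append.1 hv with hv | hv
      · have := h7 v hv; omega
      · rw [List.mem_singleton.1 hv]; exact ⟨le_rfl, le_rfl⟩

end Walk

theorem MPath.exists_walk (w : ℕ × ℕ → ℝ) (b : ℕ × ℕ → ℕ) {π : List (ℕ × ℕ)} {s t : ℕ × ℕ}
    (h : MPath π s t) : ∃ C B, Walk w b s t C B ∧ vcost w π = w s + C := by
  induction π using List.reverseRecOn generalizing t with
  | nil => exact absurd rfl h.1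
  | append_singleton l u ih =>
    obtain ⟨-, h2, h3, h4⟩ := h
    obtain rfl : u = t := by simpa using h3
    rcases l.eq_nil_or_concat' with rfl | ⟨l', v, rfl⟩
    · obtain rfl : u = s := by simpa using h2
      exact ⟨0, 0, .nil, by simp [vcost]⟩
    · obtain ⟨h5, -, h6⟩ := List.isChain_append.1 h4
      have hst : MStep v u := h6 v (by simp) u (by simp)
      obtain ⟨C, B, hW, hC⟩ := ih (t := v) ⟨by simp, by simpa using h2, by simp, h5⟩
      refine ⟨_, _, hW.snoc hst, ?_⟩
      simp only [vcost] at hC ⊢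
      rw [List.map_append, List.sum_append, hC]
      simp [add_assoc]

/-- Index `k` of a curve is a non-`⋆` position. -/
def NonStar (k : ℕ) : Prop := 8 ≤ (k - 1) % 20 ∧ (k - 1) % 20 ≤ 11

instance : DecidablePred NonStar := fun _ => inferInstanceAs (Decidable (_ ∧ _))

instance : DecidablePred GadgetBoundary := fun _ => inferInstanceAs (Decidable (_ ∨ _))

/-- Indicator of the white boundary vertices. -/
def whiteBoundary (v : ℕ × ℕ) : ℕ :=
  if ¬(NonStar v.1 ↔ NonStar v.2) ∧ GadgetBoundary v then 1 else 0

theorem whiteBoundary_swap (v : ℕ × ℕ) : whiteBoundary v.swap = whiteBoundary v := by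
  unfold whiteBoundary GadgetBoundary
  congr 1
  simp only [Prod.fst_swap, Prod.snd_swap, eq_iff_iff]
  tauto

theorem whiteBoundary_eq_zero_of_not_nonStar {v : ℕ × ℕ} (h1 : ¬NonStar v.1)
    (h2 : ¬NonStar v.2) : whiteBoundary v = 0 := by
  simp [whiteBoundary, h1, h2]

theorem whiteBoundary_eq_zero_of_interior_row {x : ℕ} (hx : ¬NonStar x) (h0 : (x - 1) % 20 ≠ 0)
    (h19 : (x - 1) % 20 ≠ 19) (y : ℕ) : whiteBoundary (x, y) = 0 := by
  by_cases hy : NonStar y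
  · rw [whiteBoundary, if_neg]
    rintro ⟨-, h⟩
    simp only [GadgetBoundary] at h
    unfold NonStar at hy
    omega
  · exact whiteBoundary_eq_zero_of_not_nonStar hx hy

/-- Number of non-`⋆` positions among the indices `1, …, n`. -/
def nonStarCount (n : ℕ) : ℕ := 4 * (n / 20) + min 4 (n % 20 - 8)

theorem sum_nonStar {m n : ℕ} (h : m ≤ n) (K L : ℝ) :
    ∑ x ∈ Finset.Ioc m n, (if NonStar x then K else L) =
      ((nonStarCount n : ℝ) - nonStarCount m) * K
        + ((n : ℝ) - m - (nonStarCount n - nonStarCount m)) * L := by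
  induction n, h using Nat.le_induction with
  | base => simp
  | succ n hn ih =>
    rw [Finset.sum_Ioc_succ_top hn, ih]
    by_cases hx : NonStar (n + 1)
    · have : nonStarCount (n + 1) = nonStarCount n + 1 := by
        unfold nonStarCount NonStar at *; omega
      rw [if_pos hx, this]; push_cast; ring
    · have : nonStarCount (n + 1) = nonStarCount n := by
        unfold nonStarCount NonStar at *; omega
      rw [if_neg hx, this]; push_cast; ring

/-- Rows `g, …, h` containing a full block of `⋆`-rows have many more `⋆`-rows than
non-`⋆`-rows. -/
theorem nonStarCount_block {i f g h k : ℕ} (hg : 1 ≤ g) (hgi : g ≤ 20 * i + 13)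
    (hih : 20 * i + 28 ≤ h) (hf : g ≤ f + 1) (hk : k ≤ h + 1) :
    4 * (nonStarCount k + 4) + 3 * nonStarCount h + 3 * (g - 1) ≤
        4 * nonStarCount f + 3 * h + 3 * nonStarCount (g - 1) ∧
      nonStarCount h + (g - 1) < h + nonStarCount (g - 1) := by
  have hmono : ∀ m n, m ≤ n → nonStarCount m ≤ nonStarCount n := fun m n hmn => by
    unfold nonStarCount; omega
  have h1 := hmono k (h + 1) hk
  have h2 := hmono (g - 1) f (by omega)
  have h3 : 4 * nonStarCount (h + 1) + 3 * nonStarCount h + 32 + 3 * (20 * i + 12) ≤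
      3 * h + 7 * (4 * i + 4) := by
    clear h1 h2 hmono
    obtain ⟨m, rfl⟩ := Nat.exists_eq_add_of_le hih
    unfold nonStarCount; omega
  have h4 : 7 * (4 * i + 4) + 3 * (g - 1) ≤
      7 * nonStarCount (g - 1) + 3 * (20 * i + 12) + 16 := by
    clear h1 h2 h3 hmono
    unfold nonStarCount; omega
  have h5 := hmono h (h + 1) (Nat.le_succ h)
  constructor <;> omega

/-- The properties of the vertex weights of the construction that matter for avoiding white
boundary vertices: orange vertices are free, and white vertices cost between `L` and `K`,
depending only on the point that is not `⋆`. -/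
structure StarWeight (w : ℕ × ℕ → ℝ) (N M : ℕ) (L K : ℝ) : Prop where
  nonneg : ∀ v, 0 ≤ w v
  orange : ∀ x y, ¬NonStar x → ¬NonStar y → w (x, y) = 0
  row_eq : ∀ x x' y, ¬NonStar x → ¬NonStar x' → w (x, y) = w (x', y)
  col_eq : ∀ x y y', ¬NonStar y → ¬NonStar y' → w (x, y) = w (x, y')
  le_white : ∀ x y, x ≤ N → y ≤ M → ¬(NonStar x ↔ NonStar y) → L ≤ w (x, y)
  white_le : ∀ x y, x ≤ N → y ≤ M → ¬(NonStar x ↔ NonStar y) → w (x, y) ≤ K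
  pos : 0 < L
  lt : 3 * K < 4 * L

namespace StarWeight

variable {w : ℕ × ℕ → ℝ} {N M : ℕ} {L K : ℝ}

theorem swap (hw : StarWeight w N M L K) : StarWeight (fun v => w v.swap) M N L K where
  nonneg _ := hw.nonneg _
  orange x y hx hy := hw.orange y x hy hx
  row_eq x x' y hx hx' := hw.col_eq y x x' hx hx'
  col_eq x y y' hy hy' := hw.row_eq y y' x hy hy'
  le_white x y hx hy h := hw.le_white y x hy hx fun h' => h h'.symm
  white_le x y hx hy h := hw.white_le y x hy hx fun h' => h h'.symm
  pos := hw.pos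
  lt := hw.lt

/-- A walk inside a block of `⋆`-rows can be rerouted to change rows only in a given `⋆`-column. -/
theorem reroute (hw : StarWeight w N M L K) {a e y₁ y₂ y : ℕ} {C : ℝ} {B : ℕ}
    (h : Walk w whiteBoundary (a, y₁) (e, y₂) C B) (hstar : ∀ x, a ≤ x → x ≤ e → ¬NonStar x)
    (hy : ¬NonStar y) (hy₁ : y₁ ≤ y) (hy₂ : y ≤ y₂)
    (ha : y₁ = y ∨ ∀ y', whiteBoundary (a, y') = 0)
    (he : y = y₂ ∨ ∀ y', whiteBoundary (e, y') = 0) :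
    ∃ C' ≤ C, Walk w whiteBoundary (a, y₁) (e, y₂) C' 0 := by
  have hae : a ≤ e := h.mono.1
  have hW := ((Walk.horizontal (w := w) (b := whiteBoundary) a hy₁).trans
    (Walk.vertical y hae)).trans (Walk.horizontal e hy₂)
  have hB₁ : ∑ y' ∈ Finset.Ioc y₁ y, whiteBoundary (a, y') = 0 := by
    rcases ha with rfl | ha
    · simp
    · exact Finset.sum_eq_zero fun y' _ => ha y'
  have hB₂ : ∑ y' ∈ Finset.Ioc y y₂, whiteBoundary (e, y') = 0 := by
    rcases he with rfl | he
    · simp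
    · exact Finset.sum_eq_zero fun y' _ => he y'
  have hB₃ : ∑ x ∈ Finset.Ioc a e, whiteBoundary (x, y) = 0 := by
    refine Finset.sum_eq_zero fun x hx => ?_
    rw [Finset.mem_Ioc] at hx
    exact whiteBoundary_eq_zero_of_not_nonStar (hstar x (by omega) hx.2) hy
  have hC₃ : ∑ x ∈ Finset.Ioc a e, w (x, y) = 0 := by
    refine Finset.sum_eq_zero fun x hx => ?_
    rw [Finset.mem_Ioc] at hx
    exact hw.orange x y (hstar x (by omega) hx.2) hy
  have hC₂ : ∑ y' ∈ Finset.Ioc y y₂, w (e, y') = ∑ y' ∈ Finset.Ioc y y₂, w (a, y') :=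
    Finset.sum_congr rfl fun y' _ =>
      hw.row_eq e a y' (hstar e hae le_rfl) (hstar a le_rfl hae)
  rw [hB₁, hB₂, hB₃, hC₃, hC₂, add_zero, Finset.sum_Ioc_consecutive _ hy₁ hy₂] at hW
  refine ⟨_, ?_, hW⟩
  exact h.sum_col_le hw.nonneg (fun y' => w (a, y')) fun v h1 h2 _ _ =>
    (hw.row_eq a v.1 v.2 (hstar a le_rfl hae) (hstar v.1 h1 h2)).le

/-- A walk that crosses a full block of `⋆`-rows inside the non-`⋆` columns of one gadget is not
of minimum cost. -/
theorem exists_cheaper (hw : StarWeight w N M L K) {i j y₁ y₂ : ℕ} {C₁ C₂ C₃ : ℝ} {B₁ B₂ B₃ : ℕ}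
    (h₁ : Walk w whiteBoundary (1, 1) (20 * i + 13, y₁) C₁ B₁)
    (h₂ : Walk w whiteBoundary (20 * i + 13, y₁) (20 * i + 28, y₂) C₂ B₂)
    (h₃ : Walk w whiteBoundary (20 * i + 28, y₂) (N, M) C₃ B₃)
    (hy₁ : 20 * j + 9 ≤ y₁) (hy₂ : y₂ ≤ 20 * j + 12) (hM : 20 * j + 13 ≤ M) :
    ∃ C' B', C' < C₁ + C₂ + C₃ ∧ Walk w whiteBoundary (1, 1) (N, M) C' B' := by
  obtain ⟨f, g, Cf, Bf, Cg, Bg, hf, hfg, hg, hf2, hg2, hC₁, -⟩ :=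
    h₁.split_col (a := 20 * j + 9) (by simp) hy₁
  obtain ⟨h, k, Ch, Bh, Ck, Bk, hh, hhk, hk, hh2, hk2, hC₃, -⟩ :=
    h₃.split_col (a := 20 * j + 13) (by simp; omega) hM
  obtain ⟨f1, f2⟩ := f
  obtain ⟨g1, g2⟩ := g
  obtain ⟨h1, h2⟩ := h
  obtain ⟨k1, k2⟩ := k
  have mf := hf.mono
  have mg := hg.mono
  have mh := hh.mono
  have mk := hk.mono
  simp only [MStep] at hf2 hg2 hh2 hk2 mf mg mh mk hfg hhk
  obtain rfl : f2 = 20 * j + 8 := by omega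
  obtain rfl : g2 = 20 * j + 9 := by omega
  obtain rfl : h2 = 20 * j + 12 := by omega
  obtain rfl : k2 = 20 * j + 13 := by omega
  have hold : ∑ x ∈ Finset.Ioc (g1 - 1) h1, (if NonStar x then 0 else L) ≤
      w (g1, 20 * j + 9) + (Cg + C₂ + Ch) := by
    have hsum := ((hg.trans h₂).trans hh).sum_row_le hw.nonneg
      (fun x => if NonStar x then 0 else L) fun v v1 v2 v3 v4 => by
        dsimp only at v1 v2 v3 v4 ⊢
        split_ifs with hv
        · exact hw.nonneg _
        · exact hw.le_white v.1 v.2 (by omega) (by omega) (by unfold NonStar at *; omega)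
    have hg' : (if NonStar g1 then 0 else L) ≤ w (g1, 20 * j + 9) := by
      split_ifs with hv
      · exact hw.nonneg _
      · exact hw.le_white _ _ (by omega) (by omega) (by unfold NonStar at *; omega)
    have hcons := Finset.sum_Ioc_consecutive (fun x => if NonStar x then 0 else L)
      (Nat.sub_le g1 1) (show g1 ≤ h1 by omega)
    have hsing : Finset.Ioc (g1 - 1) g1 = {g1} := by
      ext x; simp only [Finset.mem_Ioc, Finset.mem_singleton]; omega
    rw [hsing, Finset.sum_singleton] at hcons
    dsimp only at hsum
    linarith
  have hcol : ∀ y, ¬NonStar y → y ≤ M → ∀ m n, n ≤ N →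
      ∑ x ∈ Finset.Ioc m n, w (x, y) ≤ ∑ x ∈ Finset.Ioc m n, (if NonStar x then K else 0) := by
    intro y hy hyM m n hn
    refine Finset.sum_le_sum fun x hx => ?_
    rw [Finset.mem_Ioc] at hx
    split_ifs with hx'
    · exact hw.white_le x y (by omega) hyM (by tauto)
    · exact (hw.orange x y hx' hy).le
  have hrow : ∑ y ∈ Finset.Ioc (20 * j + 8) (20 * j + 13), w (20 * i + 13, y) ≤
      ∑ y ∈ Finset.Ioc (20 * j + 8) (20 * j + 13), (if NonStar y then K else 0) := by
    refine Finset.sum_le_sum fun y hy => ?_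
    rw [Finset.mem_Ioc] at hy
    have ha : ¬NonStar (20 * i + 13) := by unfold NonStar; omega
    split_ifs with hy'
    · exact hw.white_le _ y (by omega) (by omega) (by tauto)
    · exact (hw.orange _ y ha hy').le
  have hV₁ := hcol (20 * j + 8) (by unfold NonStar; omega) (by omega) f1 (20 * i + 13) (by omega)
  have hV₂ := hcol (20 * j + 13) (by unfold NonStar; omega) hM (20 * i + 13) k1 (by omega)
  have hW := (((hf.trans (Walk.vertical (20 * j + 8) (show f1 ≤ 20 * i + 13 by omega))).trans
    (Walk.horizontal (20 * i + 13) (show 20 * j + 8 ≤ 20 * j + 13 by omega))).trans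
    (Walk.vertical (20 * j + 13) (show 20 * i + 13 ≤ k1 by omega))).trans hk
  refine ⟨_, _, ?_, hW⟩
  have hV := Finset.sum_Ioc_consecutive (fun x => if NonStar x then K else 0)
      (show f1 ≤ 20 * i + 13 by omega) (show 20 * i + 13 ≤ k1 by omega)
  rw [sum_nonStar (by omega)] at hold hrow
  rw [sum_nonStar (show f1 ≤ k1 by omega)] at hV
  have hc : nonStarCount (20 * j + 13) = nonStarCount (20 * j + 8) + 4 := by
    clear * -
    unfold nonStarCount; omega
  have hk0 := hw.nonneg (k1, 20 * j + 13)
  obtain ⟨hcount, hlt⟩ := nonStarCount_block (i := i) (f := f1) (g := g1) (h := h1) (k := k1)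
    (by omega) (by omega) (by omega) (by omega) (by omega)
  have hK : 0 ≤ K := by
    have := (hw.le_white (20 * i + 13) (20 * j + 9) (by omega) (by omega)
      (by unfold NonStar; omega)).trans (hw.white_le (20 * i + 13) (20 * j + 9) (by omega)
      (by omega) (by unfold NonStar; omega))
    linarith [hw.pos]
  have hcountR : 4 * ((nonStarCount k1 : ℝ) - nonStarCount f1 + 4) ≤
      3 * ((h1 : ℝ) - ((g1 - 1 : ℕ) : ℝ) - (nonStarCount h1 - nonStarCount (g1 - 1))) := by
    have : (4 * (nonStarCount k1 + 4) + 3 * nonStarCount h1 + 3 * (g1 - 1 : ℕ) : ℝ) ≤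
      4 * nonStarCount f1 + 3 * h1 + 3 * nonStarCount (g1 - 1) := by exact_mod_cast hcount
    linarith
  have hltR : 0 < (h1 : ℝ) - ((g1 - 1 : ℕ) : ℝ) - (nonStarCount h1 - nonStarCount (g1 - 1)) := by
    have : (nonStarCount h1 + (g1 - 1 : ℕ) : ℝ) < h1 + nonStarCount (g1 - 1) := by
      exact_mod_cast hlt
    linarith
  have e1 := mul_le_mul_of_nonneg_right hcountR hK
  have e2 := mul_lt_mul_of_pos_left hw.lt hltR
  rw [hc] at hrow
  push_cast at hrow
  rw [hC₁, hC₃]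
  linarith

/-- A walk through a white boundary vertex whose row is a `⋆`-row is not lexicographically
minimal. -/
theorem exists_better_of_row {nr nc : ℕ} (hw : StarWeight w (20 * nr) (20 * nc) L K)
    {f g : ℕ × ℕ} {C₁ C₂ : ℝ} {B₁ B₂ : ℕ} (hf : Walk w whiteBoundary (1, 1) f C₁ B₁)
    (hfg : MStep f g) (hg : Walk w whiteBoundary g (20 * nr, 20 * nc) C₂ B₂)
    (hb : 0 < whiteBoundary g) (hrow : ¬NonStar g.1) :
    ∃ C' B', Walk w whiteBoundary (1, 1) (20 * nr, 20 * nc) C' B' ∧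
      (C' < C₁ + w g + C₂ ∨ C' ≤ C₁ + w g + C₂ ∧ B' < B₁ + whiteBoundary g + B₂) := by
  have hg' : NonStar g.2 ∧ ((g.1 - 1) % 20 = 0 ∨ (g.1 - 1) % 20 = 19) := by
    unfold whiteBoundary at hb
    split_ifs at hb with h
    · have h2 : NonStar g.2 := by tauto
      refine ⟨h2, ?_⟩
      have := h.2
      unfold GadgetBoundary at this
      unfold NonStar at h2
      omega
    · omega
  obtain ⟨hcol, hbd⟩ := hg'
  have mf := hf.mono
  have mg := hg.mono
  have hfg' := hfg
  unfold MStep at hfg'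
  dsimp only at mf mg
  by_cases hfirst : g.1 ≤ 8
  · obtain ⟨p, q, Cp, Bp, Cq, Bq, hp, hpq, hq, hp1, -, hC, hB⟩ :=
      hg.split_row (a := 9) (by omega) (by dsimp only; omega)
    obtain ⟨p1, p2⟩ := p
    obtain rfl : p1 = 8 := by dsimp only at hp1; omega
    have mp := hp.mono
    dsimp only at mp
    obtain ⟨C', hC', hW⟩ := hw.reroute ((hf.snoc hfg).trans hp) (y := 1)
      (fun x _ _ => by unfold NonStar; omega) (by unfold NonStar; omega) le_rfl (by omega)
      (Or.inl rfl)
      (Or.inr (whiteBoundary_eq_zero_of_interior_row (by unfold NonStar; omega) (by omega)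
        (by omega)))
    exact ⟨_, _, (hW.snoc hpq).trans hq, Or.inr ⟨by linarith, by omega⟩⟩
  obtain ⟨i, hi⟩ : ∃ i, g.1 = 20 * i + 20 ∨ g.1 = 20 * i + 21 := by
    refine ⟨(g.1 - 2) / 20, ?_⟩
    omega
  obtain ⟨p, q, Cp, Bp, Cq, Bq, hp, hpq, hq, -, hq1, hC, hB⟩ :=
    hf.split_row (a := 20 * i + 13) (by dsimp only; omega) (by omega)
  obtain ⟨q1, y₁⟩ := q
  obtain rfl : q1 = 20 * i + 13 := hq1
  have ha : ∀ y', whiteBoundary (20 * i + 13, y') = 0 :=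
    whiteBoundary_eq_zero_of_interior_row (by unfold NonStar; omega) (by omega) (by omega)
  have mq := hq.mono
  dsimp only at mq
  by_cases hlast : 20 * nr ≤ 20 * i + 28
  · obtain ⟨C', hC', hW⟩ := hw.reroute ((hq.snoc hfg).trans hg) (y := 20 * nc)
      (fun x _ _ => by unfold NonStar; omega) (by unfold NonStar; omega) (by omega) le_rfl
      (Or.inr ha) (Or.inl rfl)
    exact ⟨_, _, (hp.snoc hpq).trans hW, Or.inr ⟨by linarith, by omega⟩⟩
  obtain ⟨p', q', Cp', Bp', Cq', Bq', hp', hpq', hq', hp1', -, hC', hB'⟩ :=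
    hg.split_row (a := 20 * i + 29) (by omega) (by dsimp only; omega)
  obtain ⟨p1', y₂⟩ := p'
  obtain rfl : p1' = 20 * i + 28 := by dsimp only at hp1'; omega
  have mp' := hp'.mono
  have mq' := hq'.mono
  have hpq'' := hpq'
  simp only [MStep] at mp' mq' hpq''
  have hmid := (hq.snoc hfg).trans hp'
  by_cases hy : ∃ y, y₁ ≤ y ∧ y ≤ y₂ ∧ ¬NonStar y
  · obtain ⟨y, hy₁, hy₂, hy⟩ := hy
    obtain ⟨C', hC', hW⟩ := hw.reroute hmid (y := y)
      (fun x _ _ => by unfold NonStar; omega) hy hy₁ hy₂ (Or.inr ha)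
      (Or.inr (whiteBoundary_eq_zero_of_interior_row (by unfold NonStar; omega) (by omega)
        (by omega)))
    exact ⟨_, _, (((hp.snoc hpq).trans hW).snoc hpq').trans hq',
      Or.inr ⟨by linarith, by omega⟩⟩
  · push Not at hy
    have hy1 := hy y₁ le_rfl (by omega)
    obtain ⟨j, hj₁, hj₂⟩ : ∃ j, 20 * j + 9 ≤ y₁ ∧ y₁ ≤ 20 * j + 12 :=
      ⟨(y₁ - 1) / 20, by unfold NonStar at hy1; omega, by unfold NonStar at hy1; omega⟩
    have hj₃ : y₂ ≤ 20 * j + 12 := by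
      by_contra hlt
      have := hy (20 * j + 13) (by omega) (by omega)
      unfold NonStar at this
      omega
    obtain ⟨C', B', hlt, hW⟩ := hw.exists_cheaper (hp.snoc hpq) hmid
      ((Walk.single hpq').trans hq') hj₁ hj₃ (by omega)
    exact ⟨C', B', hW, Or.inl (by linarith)⟩

theorem exists_better {nr nc : ℕ} (hw : StarWeight w (20 * nr) (20 * nc) L K) {C : ℝ} {B : ℕ}
    (h : Walk w whiteBoundary (1, 1) (20 * nr, 20 * nc) C B) (hB : 0 < B) :
    ∃ C' B', Walk w whiteBoundary (1, 1) (20 * nr, 20 * nc) C' B' ∧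
      (C' < C ∨ C' ≤ C ∧ B' < B) := by
  obtain ⟨f, g, C₁, B₁, C₂, B₂, hf, hfg, hg, hb, rfl, rfl⟩ := h.exists_of_pos hB
  by_cases hrow : NonStar g.1
  · have hcol : ¬NonStar g.2 := by
      intro hcol
      simp [whiteBoundary, hrow, hcol] at hb
    have hf' := hf.swap
    have hg' := hg.swap
    simp only [whiteBoundary_swap] at hf' hg'
    have hfg' : MStep f.swap g.swap := by
      unfold MStep at *; simp only [Prod.fst_swap, Prod.snd_swap]; omega
    obtain ⟨C', B', hW, hlt⟩ := hw.swap.exists_better_of_row hf' hfg' hg'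
      (by rwa [whiteBoundary_swap]) hcol
    have hW' := hW.swap
    simp only [whiteBoundary_swap, Prod.swap_swap] at hW' hlt
    exact ⟨C', B', hW', hlt⟩
  · exact hw.exists_better_of_row hf hfg hg hb hrow

/-- Some minimum-cost walk avoids all white boundary vertices. -/
theorem exists_optimal {nr nc : ℕ} (hw : StarWeight w (20 * nr) (20 * nc) L K) (hnr : 1 ≤ nr)
    (hnc : 1 ≤ nc) :
    ∃ C, Walk w whiteBoundary (1, 1) (20 * nr, 20 * nc) C 0 ∧
      ∀ C' B', Walk w whiteBoundary (1, 1) (20 * nr, 20 * nc) C' B' → C ≤ C' := by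
  have hne : {p : ℝ × ℕ | Walk w whiteBoundary (1, 1) (20 * nr, 20 * nc) p.1 p.2}.Nonempty :=
    ⟨(_, _), (Walk.horizontal 1 (show 1 ≤ 20 * nc by omega)).trans
      (Walk.vertical (20 * nc) (show 1 ≤ 20 * nr by omega))⟩
  obtain ⟨⟨C, B⟩, hCB, hmin⟩ := Set.exists_min_image _ (fun p : ℝ × ℕ => toLex p)
    (Walk.finite_weights w whiteBoundary (1, 1) (20 * nr, 20 * nc)) hne
  have hmin' : ∀ C' B', Walk w whiteBoundary (1, 1) (20 * nr, 20 * nc) C' B' →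
      C < C' ∨ C = C' ∧ B ≤ B' := fun C' B' h => by
    simpa [Prod.Lex.toLex_le_toLex] using hmin (C', B') h
  have hB : B = 0 := by
    by_contra hB
    obtain ⟨C', B', hW, hlt⟩ := hw.exists_better hCB (Nat.pos_of_ne_zero hB)
    rcases hmin' C' B' hW with h | ⟨h, h'⟩ <;> rcases hlt with hlt | ⟨hlt, hlt'⟩
    · linarith
    · linarith
    · linarith
    · omega
  subst hB
  exact ⟨C, hCB, fun C' B' h => (hmin' C' B' h).elim le_of_lt fun h => h.1.le⟩

end StarWeight

/-- Curves that equal `⋆ = -V⁵` at `⋆`-positions and are nonnegative and small elsewhere induce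
weights of the required form. -/
theorem starWeight_abs_sub {p q : ℕ → ℝ} {N M : ℕ} {V : ℝ} (hV : 100 ≤ V)
    (hp : ∀ k, ¬NonStar k → p k = -V ^ 5)
    (hp' : ∀ k ≤ N, NonStar k → 0 ≤ p k ∧ p k ≤ 5 * V ^ 4)
    (hq : ∀ k, ¬NonStar k → q k = -V ^ 5)
    (hq' : ∀ k ≤ M, NonStar k → 0 ≤ q k ∧ q k ≤ 5 * V ^ 4) :
    StarWeight (fun v => |p v.1 - q v.2|) N M (V ^ 5) (V ^ 5 + 5 * V ^ 4) := by
  have h5 : 0 < V ^ 5 := by positivity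
  have h4 : 0 < V ^ 4 := by positivity
  have hwhite : ∀ x y, x ≤ N → y ≤ M → ¬(NonStar x ↔ NonStar y) →
      V ^ 5 ≤ |p x - q y| ∧ |p x - q y| ≤ V ^ 5 + 5 * V ^ 4 := by
    intro x y hx hy h
    by_cases h1 : NonStar x
    · have h2 : ¬NonStar y := by tauto
      obtain ⟨h3, h4⟩ := hp' x hx h1
      rw [hq y h2, abs_of_nonneg (by linarith)]
      constructor <;> linarith
    · have h2 : NonStar y := by tauto
      obtain ⟨h3, h4⟩ := hq' y hy h2
      rw [hp x h1, abs_of_nonpos (by linarith)]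
      constructor <;> linarith
  refine ⟨fun _ => abs_nonneg _, fun x y hx hy => ?_, fun x x' y hx hx' => ?_,
    fun x y y' hy hy' => ?_, fun x y hx hy h => (hwhite x y hx hy h).1,
    fun x y hx hy h => (hwhite x y hx hy h).2, h5, ?_⟩
  · simp [hp x hx, hq y hy]
  · simp only [hp x hx, hp x' hx']
  · simp only [hq y hy, hq y' hy']
  · have : V ^ 5 = V * V ^ 4 := by ring
    rw [this]
    linarith [mul_le_mul_of_nonneg_right hV h4.le]

theorem Pcur_of_not_nonStar (U : ℕ) (r d : ℕ → ℕ) {k : ℕ} (h : ¬NonStar k) :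
    Pcur U r d k = starPt U := by
  unfold NonStar at h
  unfold Pcur alphaVal
  rw [if_neg (by omega), if_neg (by omega), if_neg (by omega), if_neg (by omega)]

theorem Qcur_of_not_nonStar (U : ℕ) (c b : ℕ → ℕ) {k : ℕ} (h : ¬NonStar k) :
    Qcur U c b k = starPt U := by
  unfold NonStar at h
  unfold Qcur betaVal
  rw [if_neg (by omega), if_neg (by omega), if_neg (by omega), if_neg (by omega)]

theorem Pcur_bounds {U n : ℕ} {r d : ℕ → ℕ} (hU : 100 ≤ U) (hr : ∀ i < n, 100 * r i ≤ U)
    (hd : ∀ i < n, d i ≤ U) {k : ℕ} (hk : k ≤ 20 * n) (h : NonStar k) :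
    0 ≤ Pcur U r d k ∧ Pcur U r d k ≤ 5 * (U : ℝ) ^ 4 := by
  unfold NonStar at h
  have hi : (k - 1) / 20 < n := by omega
  unfold Pcur alphaVal
  set i := (k - 1) / 20
  have hU' : (100 : ℝ) ≤ U := by exact_mod_cast hU
  have hr' : 100 * (r i : ℝ) ≤ U := by exact_mod_cast hr i hi
  have hd' : (d i : ℝ) ≤ U := by exact_mod_cast hd i hi
  have hr0 : (0 : ℝ) ≤ r i := by positivity
  have hd0 : (0 : ℝ) ≤ d i := by positivity
  have e1 : 100 * (r i : ℝ) * (U : ℝ) ^ 3 ≤ (U : ℝ) ^ 4 := by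
    calc 100 * (r i : ℝ) * (U : ℝ) ^ 3 ≤ U * (U : ℝ) ^ 3 := by gcongr
      _ = (U : ℝ) ^ 4 := by ring
  have e2 : (U : ℝ) ≤ (U : ℝ) ^ 4 := le_self_pow₀ (by linarith) (by norm_num)
  have e3 : 0 ≤ (r i : ℝ) * (U : ℝ) ^ 3 := by positivity
  split_ifs
  all_goals first
    | omega
    | constructor <;> linarith

theorem Qcur_bounds {U n : ℕ} {c b : ℕ → ℕ} (hU : 100 ≤ U) (hc : ∀ i < n, 100 * c i ≤ U)
    {k : ℕ} (hk : k ≤ 20 * n) (h : NonStar k) :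
    0 ≤ Qcur U c b k ∧ Qcur U c b k ≤ 5 * (U : ℝ) ^ 4 := by
  unfold NonStar at h
  have hi : (k - 1) / 20 < n := by omega
  unfold Qcur betaVal
  set i := (k - 1) / 20
  have hU' : (100 : ℝ) ≤ U := by exact_mod_cast hU
  have hc' : 100 * (c i : ℝ) ≤ U := by exact_mod_cast hc i hi
  have hc0 : (0 : ℝ) ≤ c i := by positivity
  have e1 : 100 * (c i : ℝ) * (U : ℝ) ^ 3 ≤ (U : ℝ) ^ 4 := by
    calc 100 * (c i : ℝ) * (U : ℝ) ^ 3 ≤ U * (U : ℝ) ^ 3 := by gcongr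
      _ = (U : ℝ) ^ 4 := by ring
  have e2 : (U : ℝ) ≤ (U : ℝ) ^ 4 / 4 := by
    have : (U : ℝ) * 100 ^ 3 ≤ U * (U : ℝ) ^ 3 := by gcongr
    have h4 : (U : ℝ) ^ 4 = U * (U : ℝ) ^ 3 := by ring
    linarith
  have e3 : 0 ≤ (c i : ℝ) * (U : ℝ) ^ 3 := by positivity
  rcases neg_one_pow_eq_or ℝ (b i) with hs | hs <;> rw [hs] <;> split_ifs
  all_goals first
    | omega
    | constructor <;> linarith

/-- For the curves `P` and `Q` of the DTW lower-bound
construction, there exists an xy-monotone path from `(1,1)` to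
`(20·n_r, 20·n_c)` in the induced vertex-weighted grid whose cost equals
`DTW(P,Q)` and which contains no white boundary vertices. -/
theorem stmt4 (nr nc : ℕ) (hnr : 1 ≤ nr) (hnc : 1 ≤ nc)
    (r d : ℕ → ℕ) (c b : ℕ → ℕ) (hb : ∀ j, b j ≤ 1) (U : ℕ)
    (hU : 100 * nr * nc * (1 + (Finset.range nr).sup d) ^ 2
        * (1 + (Finset.range nr).sup r) ^ 2
        * (1 + (Finset.range nc).sup c) ^ 2 < U) :
    ∃ π : List (ℕ × ℕ), MPath π (1, 1) (20 * nr, 20 * nc) ∧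
      vcost (fun v => |Pcur U r d v.1 - Qcur U c b v.2|) π
        = sInf {t : ℝ | ∃ π' : List (ℕ × ℕ), MPath π' (1, 1) (20 * nr, 20 * nc) ∧
            t = vcost (fun v => |Pcur U r d v.1 - Qcur U c b v.2|) π'} ∧
      ∀ v ∈ π, ¬ (White U r d c b v ∧ GadgetBoundary v) := by
  have hsup : ∀ (f : ℕ → ℕ) (n i : ℕ), i < n → f i ≤ (Finset.range n).sup f := fun f n i hi =>
    Finset.le_sup (f := f) (Finset.mem_range.2 hi)
  set D := (Finset.range nr).sup d
  set R := (Finset.range nr).sup r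
  set S := (Finset.range nc).sup c
  have hsq : ∀ X : ℕ, 1 ≤ (1 + X) ^ 2 ∧ X ≤ (1 + X) ^ 2 := fun X => ⟨Nat.one_le_pow _ _ (by omega), by nlinarith⟩
  have hUmax : 100 ≤ U ∧ D ≤ U ∧ 100 * R ≤ U ∧ 100 * S ≤ U := by
    obtain ⟨d1, d2⟩ := hsq D
    obtain ⟨r1, r2⟩ := hsq R
    obtain ⟨s1, s2⟩ := hsq S
    have bound : ∀ x y z, x ≤ (1 + D) ^ 2 → y ≤ (1 + R) ^ 2 → z ≤ (1 + S) ^ 2 →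
        100 * 1 * 1 * x * y * z ≤ U := fun x y z hx hy hz => le_trans (by gcongr) hU.le
    have h1 := bound 1 1 1 d1 r1 s1
    have h2 := bound D 1 1 d2 r1 s1
    have h3 := bound 1 R 1 d1 r2 s1
    have h4 := bound 1 1 S d1 r1 s2
    refine ⟨?_, ?_, ?_, ?_⟩ <;> omega
  obtain ⟨hU100, hDU, hRU, hSU⟩ := hUmax
  have hP : ∀ k ≤ 20 * nr, NonStar k → 0 ≤ Pcur U r d k ∧ Pcur U r d k ≤ 5 * (U : ℝ) ^ 4 :=
    fun k hk h => Pcur_bounds hU100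
      (fun i hi => (Nat.mul_le_mul_left _ (hsup r nr i hi)).trans hRU)
      (fun i hi => (hsup d nr i hi).trans hDU) hk h
  have hQ : ∀ k ≤ 20 * nc, NonStar k → 0 ≤ Qcur U c b k ∧ Qcur U c b k ≤ 5 * (U : ℝ) ^ 4 :=
    fun k hk h => Qcur_bounds hU100
      (fun i hi => (Nat.mul_le_mul_left _ (hsup c nc i hi)).trans hSU) hk h
  have hw := starWeight_abs_sub (by exact_mod_cast hU100)
    (fun k h => Pcur_of_not_nonStar U r d h) hP (fun k h => Qcur_of_not_nonStar U c b h) hQ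
  have hstar : starPt U < 0 := by
    have : (0 : ℝ) < U := by exact_mod_cast (by omega : 0 < U)
    have := pow_pos this 5
    unfold starPt
    linarith
  obtain ⟨C, hW, hmin⟩ := hw.exists_optimal hnr hnc
  obtain ⟨π, hπ, hcost, hbad, hle⟩ := hW.exists_list
  refine ⟨π, hπ, ?_, ?_⟩
  · symm
    apply IsLeast.csInf_eq
    refine ⟨⟨π, hπ, rfl⟩, ?_⟩
    rintro _ ⟨π', hπ', rfl⟩
    obtain ⟨C', B', hW', hcost'⟩ := hπ'.exists_walk (fun v => |Pcur U r d v.1 - Qcur U c b v.2|)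
      whiteBoundary
    rw [hcost, hcost']
    gcongr
    exact hmin C' B' hW'
  · rintro v hv ⟨hwhite, hbd⟩
    obtain ⟨h1, h2⟩ := hle v hv
    have hzero : whiteBoundary v = 0 := by
      have h0 : whiteBoundary (1, 1) = 0 :=
        whiteBoundary_eq_zero_of_not_nonStar (by simp [NonStar]) (by simp [NonStar])
      rw [h0, add_zero, List.sum_eq_zero_iff] at hbad
      exact hbad _ (List.mem_map_of_mem hv)
    have hxor : ¬(NonStar v.1 ↔ NonStar v.2) := by
      rcases hwhite with ⟨hp, hq⟩ | ⟨hp, hq⟩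
      · have n1 : ¬NonStar v.1 := fun h => by linarith [(hP _ h1 h).1]
        have n2 : NonStar v.2 := by_contra fun h => hq (Qcur_of_not_nonStar U c b h)
        tauto
      · have n1 : ¬NonStar v.2 := fun h => by linarith [(hQ _ h2 h).1]
        have n2 : NonStar v.1 := by_contra fun h => hp (Pcur_of_not_nonStar U r d h)
        tauto
    simp [whiteBoundary, hxor, hbd] at hzero
end

section
/- In the DTW lower-bound construction, let B₁ and B₂ be two blocks that are diagonally adjacent, and let R_{ij} be the unique gadget that intersects both. Then for every u ∈ B₁ and v ∈ B₂ with u ≤ v componentwise: if r_i ≠ c_j, the minimum cost of an xy-monotone path from u to v in the induced vertex-weighted grid is strictly greater than U³; and if r_i = c_j, this minimum cost equals 4U + d_i·b_j. -/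
/-- The set of orange vertices of the grid: both curve points equal `⋆`. -/
noncomputable def orangeSet (nr nc U : ℕ) (r d c b : ℕ → ℕ) : Set (ℕ × ℕ) :=
  {v | 1 ≤ v.1 ∧ v.1 ≤ 20 * nr ∧ 1 ≤ v.2 ∧ v.2 ≤ 20 * nc ∧
    Pcur U r d v.1 = starPt U ∧ Qcur U c b v.2 = starPt U}

/-- Two grid vertices are adjacent if they differ by at most 1 in each
coordinate. -/
def kingAdj (u v : ℕ × ℕ) : Prop :=
  u.1 ≤ v.1 + 1 ∧ v.1 ≤ u.1 + 1 ∧ u.2 ≤ v.2 + 1 ∧ v.2 ≤ u.2 + 1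

/-- `B` is a block: a connected component of the set `O` of orange vertices. -/
def IsBlock (O : Set (ℕ × ℕ)) (B : Set (ℕ × ℕ)) : Prop :=
  ∃ v ∈ O, B = {u | u ∈ O ∧
    Relation.ReflTransGen (fun a b => a ∈ O ∧ b ∈ O ∧ kingAdj a b) v u}

/-- Blocks `B₁`, `B₂` are horizontally adjacent: some grid row intersects them
consecutively, with no vertex of a third block between them on that row. -/
def HorizAdj (O B₁ B₂ : Set (ℕ × ℕ)) : Prop :=
  ∃ x y₁ y₂ : ℕ, y₁ < y₂ ∧
    (((x, y₁) ∈ B₁ ∧ (x, y₂) ∈ B₂) ∨ ((x, y₁) ∈ B₂ ∧ (x, y₂) ∈ B₁)) ∧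
    ∀ y', y₁ < y' → y' < y₂ →
      ∀ B₃, IsBlock O B₃ → B₃ ≠ B₁ → B₃ ≠ B₂ → (x, y') ∉ B₃

/-- Blocks `B₁`, `B₂` are vertically adjacent: some grid column intersects them
consecutively, with no vertex of a third block between them on that column. -/
def VertAdj (O B₁ B₂ : Set (ℕ × ℕ)) : Prop :=
  ∃ y x₁ x₂ : ℕ, x₁ < x₂ ∧
    (((x₁, y) ∈ B₁ ∧ (x₂, y) ∈ B₂) ∨ ((x₁, y) ∈ B₂ ∧ (x₂, y) ∈ B₁)) ∧
    ∀ x', x₁ < x' → x' < x₂ →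
      ∀ B₃, IsBlock O B₃ → B₃ ≠ B₁ → B₃ ≠ B₂ → (x', y) ∉ B₃

/-- Blocks `B₁`, `B₂` are diagonally adjacent: they are neither horizontally
nor vertically adjacent, and some diagonal `{(x+t, y+t)}` intersects them
consecutively, with no vertex of a third block between them on that diagonal. -/
def DiagAdj (O B₁ B₂ : Set (ℕ × ℕ)) : Prop :=
  ¬ HorizAdj O B₁ B₂ ∧ ¬ VertAdj O B₁ B₂ ∧
  ∃ x y t₁ t₂ : ℕ, t₁ < t₂ ∧
    (((x + t₁, y + t₁) ∈ B₁ ∧ (x + t₂, y + t₂) ∈ B₂) ∨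
     ((x + t₁, y + t₁) ∈ B₂ ∧ (x + t₂, y + t₂) ∈ B₁)) ∧
    ∀ t', t₁ < t' → t' < t₂ →
      ∀ B₃, IsBlock O B₃ → B₃ ≠ B₁ → B₃ ≠ B₂ → (x + t', y + t') ∉ B₃

/-- The gadget `R_{ij}`: the 20×20 subgrid corresponding to `α_i × β_j`. -/
def Gadget (i j : ℕ) : Set (ℕ × ℕ) :=
  {v | 1 ≤ v.1 ∧ 1 ≤ v.2 ∧ (v.1 - 1) / 20 = i ∧ (v.2 - 1) / 20 = j}

theorem alphaVal_of_star {o : ℕ} (U : ℕ) (r d : ℕ → ℕ) (i : ℕ) (h : o < 8 ∨ 11 < o) :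
    alphaVal U r d i o = starPt U := by
  unfold alphaVal
  rw [if_neg (by omega), if_neg (by omega), if_neg (by omega), if_neg (by omega)]

theorem betaVal_of_star {o : ℕ} (U : ℕ) (c b : ℕ → ℕ) (j : ℕ) (h : o < 8 ∨ 11 < o) :
    betaVal U c b j o = starPt U := by
  unfold betaVal
  rw [if_neg (by omega), if_neg (by omega), if_neg (by omega), if_neg (by omega)]

theorem Pcur_add {o : ℕ} (U : ℕ) (r d : ℕ → ℕ) (i : ℕ) (ho : o < 20) :
    Pcur U r d (20 * i + (o + 1)) = alphaVal U r d i o := by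
  unfold Pcur
  congr 1 <;> omega

theorem Qcur_add {o : ℕ} (U : ℕ) (c b : ℕ → ℕ) (j : ℕ) (ho : o < 20) :
    Qcur U c b (20 * j + (o + 1)) = betaVal U c b j o := by
  unfold Qcur
  congr 1 <;> omega

/-- The four middle points of `α_i` are close to the multiples of `U⁴`. -/
theorem abs_alphaVal_sub_le {U : ℕ} {r d : ℕ → ℕ} {i o : ℕ} (hr : 100 * (1 + r i) ≤ U)
    (hd : 100 * (1 + d i) ≤ U) (h₁ : 8 ≤ o) (h₂ : o ≤ 11) :
    |alphaVal U r d i o - ((o : ℝ) - 7) * (U : ℝ) ^ 4| ≤ (U : ℝ) ^ 4 / 4 := by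
  have hr' : 100 * (1 + (r i : ℝ)) ≤ U := by exact_mod_cast hr
  have hd' : 100 * (1 + (d i : ℝ)) ≤ U := by exact_mod_cast hd
  have hr0 : (0 : ℝ) ≤ r i := by positivity
  have hd0 : (0 : ℝ) ≤ d i := by positivity
  have hU : (1 : ℝ) ≤ U := by linarith
  have h3 : (1 : ℝ) ≤ (U : ℝ) ^ 3 := one_le_pow₀ hU
  have h4 : 100 * (1 + (r i : ℝ)) * (U : ℝ) ^ 3 ≤ (U : ℝ) ^ 4 := by
    calc _ ≤ (U : ℝ) * (U : ℝ) ^ 3 := by gcongr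
      _ = _ := by ring
  have h5 : 100 * (1 + (d i : ℝ)) ≤ (U : ℝ) ^ 4 := hd'.trans (le_self_pow₀ hU (by norm_num))
  have h6 : 0 ≤ (r i : ℝ) * (U : ℝ) ^ 3 := by positivity
  rw [abs_le]
  interval_cases o <;> simp only [alphaVal] <;> norm_num <;> constructor <;> linarith

/-- The four middle points of `β_j` are close to the multiples of `U⁴`. -/
theorem abs_betaVal_sub_le {U : ℕ} {c b : ℕ → ℕ} {j o : ℕ} (hc : 100 * (1 + c j) ≤ U)
    (h₁ : 8 ≤ o) (h₂ : o ≤ 11) :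
    |betaVal U c b j o - ((o : ℝ) - 7) * (U : ℝ) ^ 4| ≤ (U : ℝ) ^ 4 / 4 := by
  have hc' : 100 * (1 + (c j : ℝ)) ≤ U := by exact_mod_cast hc
  have hc0 : (0 : ℝ) ≤ c j := by positivity
  have hU : (1 : ℝ) ≤ U := by linarith
  have h4 : 100 * (1 + (c j : ℝ)) * (U : ℝ) ^ 3 ≤ (U : ℝ) ^ 4 := by
    calc _ ≤ (U : ℝ) * (U : ℝ) ^ 3 := by gcongr
      _ = _ := by ring
  have h5 : (U : ℝ) ≤ (U : ℝ) ^ 3 := le_self_pow₀ hU (by norm_num)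
  have h6 : 0 ≤ (c j : ℝ) * (U : ℝ) ^ 3 := by positivity
  rw [abs_le]
  rcases neg_one_pow_eq_or ℝ (b j) with hb | hb <;>
  interval_cases o <;> simp only [betaVal, hb] <;> norm_num <;> constructor <;> linarith

theorem starPt_neg {U : ℕ} (hU : 0 < U) : starPt U < 0 := by
  have : (0 : ℝ) < U := by exact_mod_cast hU
  unfold starPt
  simp only [Left.neg_neg_iff]
  positivity

theorem nonneg_of_abs_sub_le {o : ℕ} {z V : ℝ} (hV : 0 ≤ V) (ho : 8 ≤ o)
    (h : |z - ((o : ℝ) - 7) * V| ≤ V / 4) : 0 ≤ z := by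
  have ho' : (8 : ℝ) ≤ o := by exact_mod_cast ho
  have := (abs_le.1 h).1
  nlinarith

theorem alphaVal_nonneg {U : ℕ} {r d : ℕ → ℕ} {i o : ℕ} (hr : 100 * (1 + r i) ≤ U)
    (hd : 100 * (1 + d i) ≤ U) (h₁ : 8 ≤ o) (h₂ : o ≤ 11) : 0 ≤ alphaVal U r d i o :=
  nonneg_of_abs_sub_le (by positivity) h₁ (abs_alphaVal_sub_le hr hd h₁ h₂)

theorem betaVal_nonneg {U : ℕ} {c b : ℕ → ℕ} {j o : ℕ} (hc : 100 * (1 + c j) ≤ U)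
    (h₁ : 8 ≤ o) (h₂ : o ≤ 11) : 0 ≤ betaVal U c b j o :=
  nonneg_of_abs_sub_le (by positivity) h₁ (abs_betaVal_sub_le hc h₁ h₂)

/-- The indices of the copies of `⋆` in a curve made of `n` gadget pieces. -/
def starIndices (n : ℕ) : Set ℕ := {k | 1 ≤ k ∧ k ≤ 20 * n ∧ ((k - 1) % 20 < 8 ∨ 11 < (k - 1) % 20)}

theorem mem_starIndices {n k : ℕ} : k ∈ starIndices n ↔
    1 ≤ k ∧ k ≤ 20 * n ∧ ((k - 1) % 20 < 8 ∨ 11 < (k - 1) % 20) := Iff.rfl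

/-- Orange vertices are those both of whose coordinates are indices of copies of `⋆`. -/
theorem orangeSet_eq {nr nc U : ℕ} {r d c b : ℕ → ℕ} (hU : 0 < U)
    (hr : ∀ i < nr, 100 * (1 + r i) ≤ U) (hd : ∀ i < nr, 100 * (1 + d i) ≤ U)
    (hc : ∀ j < nc, 100 * (1 + c j) ≤ U) :
    orangeSet nr nc U r d c b = starIndices nr ×ˢ starIndices nc := by
  have hs := starPt_neg hU
  ext p
  rw [Set.mem_prod, mem_starIndices, mem_starIndices]
  constructor
  · rintro ⟨h1, h2, h3, h4, h5, h6⟩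
    refine ⟨⟨h1, h2, ?_⟩, h3, h4, ?_⟩
    · by_contra h
      have hi : (p.1 - 1) / 20 < nr := by omega
      have h0 := alphaVal_nonneg (o := (p.1 - 1) % 20) (hr _ hi) (hd _ hi) (by omega) (by omega)
      unfold Pcur at h5
      linarith
    · by_contra h
      have hj : (p.2 - 1) / 20 < nc := by omega
      have h0 := betaVal_nonneg (b := b) (o := (p.2 - 1) % 20) (hc _ hj) (by omega) (by omega)
      unfold Qcur at h6
      linarith
  · rintro ⟨⟨h1, h2, h3⟩, h4, h5, h6⟩
    exact ⟨h1, h2, h4, h5, alphaVal_of_star U r d _ h3, betaVal_of_star U c b _ h6⟩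

/-- The king-move relation inside `O`. -/
def KingIn (O : Set (ℕ × ℕ)) (p q : ℕ × ℕ) : Prop := p ∈ O ∧ q ∈ O ∧ kingAdj p q

theorem KingIn.reflTransGen_symm {O : Set (ℕ × ℕ)} {p q : ℕ × ℕ}
    (h : Relation.ReflTransGen (KingIn O) p q) : Relation.ReflTransGen (KingIn O) q p := by
  induction h with
  | refl => exact .refl
  | tail _ h ih =>
    obtain ⟨h1, h2, h3, h4, h5, h6⟩ := h
    exact .head ⟨h2, h1, h4, h3, h6, h5⟩ ih

theorem reflTransGen_kingIn_fst {nr nc x y : ℕ} (n : ℕ)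
    (hx : x ∈ starIndices nr) (hx' : x + n ∈ starIndices nr) (hy : y ∈ starIndices nc)
    (h : (x + n + 7) / 20 = (x + 7) / 20) :
    Relation.ReflTransGen (KingIn (starIndices nr ×ˢ starIndices nc)) (x, y) (x + n, y) := by
  induction n with
  | zero => exact .refl
  | succ n ih =>
    have hn : x + n ∈ starIndices nr := by rw [mem_starIndices] at *; omega
    refine .tail (ih hn (by omega)) ⟨⟨hn, hy⟩, ⟨hx', hy⟩, ?_⟩
    simp only [kingAdj]
    omega

theorem reflTransGen_kingIn_snd {nr nc x y : ℕ} (n : ℕ)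
    (hx : x ∈ starIndices nr) (hy : y ∈ starIndices nc) (hy' : y + n ∈ starIndices nc)
    (h : (y + n + 7) / 20 = (y + 7) / 20) :
    Relation.ReflTransGen (KingIn (starIndices nr ×ˢ starIndices nc)) (x, y) (x, y + n) := by
  induction n with
  | zero => exact .refl
  | succ n ih =>
    have hn : y + n ∈ starIndices nc := by rw [mem_starIndices] at *; omega
    refine .tail (ih hn (by omega)) ⟨⟨hx, hn⟩, ⟨hx, hy'⟩, ?_⟩
    simp only [kingAdj]
    omega

/-- Two orange vertices are connected iff their coordinates lie in the same runs of copies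
of `⋆`. -/
theorem reflTransGen_kingIn_iff {nr nc : ℕ} {p q : ℕ × ℕ}
    (hp : p ∈ starIndices nr ×ˢ starIndices nc) (hq : q ∈ starIndices nr ×ˢ starIndices nc) :
    Relation.ReflTransGen (KingIn (starIndices nr ×ˢ starIndices nc)) p q ↔
      (q.1 + 7) / 20 = (p.1 + 7) / 20 ∧ (q.2 + 7) / 20 = (p.2 + 7) / 20 := by
  constructor
  · intro h
    clear hq
    induction h with
    | refl => exact ⟨rfl, rfl⟩
    | tail _ h ih =>
      obtain ⟨⟨h1, h2⟩, ⟨h3, h4⟩, h5, h6, h7, h8⟩ := h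
      rw [mem_starIndices] at h1 h2 h3 h4
      omega
  · obtain ⟨x, y⟩ := p
    obtain ⟨x', y'⟩ := q
    obtain ⟨hx, hy⟩ := hp
    obtain ⟨hx', hy'⟩ := hq
    rintro ⟨h1, h2⟩
    dsimp only at *
    trans (x', y)
    · rcases le_total x x' with hle | hle <;> obtain ⟨n, rfl⟩ := Nat.exists_eq_add_of_le hle
      · exact reflTransGen_kingIn_fst n hx hx' hy h1
      · exact KingIn.reflTransGen_symm (reflTransGen_kingIn_fst n hx' hx hy h1.symm)
    · rcases le_total y y' with hle | hle <;> obtain ⟨n, rfl⟩ := Nat.exists_eq_add_of_le hle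
      · exact reflTransGen_kingIn_snd n hx' hy hy' h2
      · exact KingIn.reflTransGen_symm (reflTransGen_kingIn_snd n hx' hy' hy h2.symm)

/-- A block consists of the orange vertices in the same runs of copies of `⋆` as any one of
its vertices. -/
theorem IsBlock.mem_iff {nr nc : ℕ} {B : Set (ℕ × ℕ)} {p : ℕ × ℕ}
    (hB : IsBlock (starIndices nr ×ˢ starIndices nc) B) (hp : p ∈ B) (q : ℕ × ℕ) :
    q ∈ B ↔ q ∈ starIndices nr ×ˢ starIndices nc ∧
      (q.1 + 7) / 20 = (p.1 + 7) / 20 ∧ (q.2 + 7) / 20 = (p.2 + 7) / 20 := by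
  obtain ⟨v, hv, rfl⟩ := hB
  have hpv := (reflTransGen_kingIn_iff hv hp.1).1 hp.2
  constructor
  · rintro ⟨hq, h⟩
    have := (reflTransGen_kingIn_iff hv hq).1 h
    exact ⟨hq, by omega⟩
  · rintro ⟨hq, h⟩
    exact ⟨hq, (reflTransGen_kingIn_iff hv hq).2 (by omega)⟩

theorem IsBlock.subset {nr nc : ℕ} {B : Set (ℕ × ℕ)}
    (hB : IsBlock (starIndices nr ×ˢ starIndices nc) B) : B ⊆ starIndices nr ×ˢ starIndices nc := by
  obtain ⟨v, hv, rfl⟩ := hB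
  exact fun _ h => h.1

theorem IsBlock.eq_of_segment_eq {nr nc : ℕ} {B B' : Set (ℕ × ℕ)} {p q : ℕ × ℕ}
    (hB : IsBlock (starIndices nr ×ˢ starIndices nc) B)
    (hB' : IsBlock (starIndices nr ×ˢ starIndices nc) B') (hp : p ∈ B) (hq : q ∈ B')
    (h₁ : (q.1 + 7) / 20 = (p.1 + 7) / 20) (h₂ : (q.2 + 7) / 20 = (p.2 + 7) / 20) : B = B' := by
  ext s
  rw [hB.mem_iff hp, hB'.mem_iff hq, h₁, h₂]

/-- Distinct blocks in the same rows that meet a common gadget are horizontally adjacent. -/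
theorem IsBlock.horizAdj {nr nc : ℕ} {B B' : Set (ℕ × ℕ)} {p q : ℕ × ℕ}
    (hB : IsBlock (starIndices nr ×ˢ starIndices nc) B)
    (hB' : IsBlock (starIndices nr ×ˢ starIndices nc) B') (hp : p ∈ B) (hq : q ∈ B')
    (hne : B ≠ B') (h₁ : (q.1 + 7) / 20 = (p.1 + 7) / 20) (h₂ : (q.2 - 1) / 20 = (p.2 - 1) / 20) :
    HorizAdj (starIndices nr ×ˢ starIndices nc) B B' := by
  have hpO := hB.subset hp
  have hqO := hB'.subset hq
  have hne' : (q.2 + 7) / 20 ≠ (p.2 + 7) / 20 := fun h => hne (hB.eq_of_segment_eq hB' hp hq h₁ h)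
  have hq' : (p.1, q.2) ∈ B' := (hB'.mem_iff hq _).2 ⟨⟨hpO.1, hqO.2⟩, h₁.symm, rfl⟩
  have key : ∀ y', min p.2 q.2 < y' → y' < max p.2 q.2 →
      ∀ B₃, IsBlock (starIndices nr ×ˢ starIndices nc) B₃ → B₃ ≠ B → B₃ ≠ B' →
        (p.1, y') ∉ B₃ := by
    intro y' hy1 hy2 B₃ hB₃ hn hn' hmem
    have h : (y' + 7) / 20 = (p.2 + 7) / 20 ∨ (y' + 7) / 20 = (q.2 + 7) / 20 := by omega
    rcases h with h | h
    · exact hn (hB.eq_of_segment_eq hB₃ hp hmem rfl h).symm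
    · exact hn' (hB'.eq_of_segment_eq hB₃ hq hmem h₁.symm h).symm
  refine ⟨p.1, min p.2 q.2, max p.2 q.2, by omega, ?_, key⟩
  rcases le_total p.2 q.2 with h | h
  · rw [min_eq_left h, max_eq_right h]
    exact .inl ⟨hp, hq'⟩
  · rw [min_eq_right h, max_eq_left h]
    exact .inr ⟨hq', hp⟩

/-- Distinct blocks in the same columns that meet a common gadget are vertically adjacent. -/
theorem IsBlock.vertAdj {nr nc : ℕ} {B B' : Set (ℕ × ℕ)} {p q : ℕ × ℕ}
    (hB : IsBlock (starIndices nr ×ˢ starIndices nc) B)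
    (hB' : IsBlock (starIndices nr ×ˢ starIndices nc) B') (hp : p ∈ B) (hq : q ∈ B')
    (hne : B ≠ B') (h₁ : (q.2 + 7) / 20 = (p.2 + 7) / 20) (h₂ : (q.1 - 1) / 20 = (p.1 - 1) / 20) :
    VertAdj (starIndices nr ×ˢ starIndices nc) B B' := by
  have hpO := hB.subset hp
  have hqO := hB'.subset hq
  have hne' : (q.1 + 7) / 20 ≠ (p.1 + 7) / 20 := fun h => hne (hB.eq_of_segment_eq hB' hp hq h h₁)
  have hq' : (q.1, p.2) ∈ B' := (hB'.mem_iff hq _).2 ⟨⟨hqO.1, hpO.2⟩, rfl, h₁.symm⟩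
  have key : ∀ x', min p.1 q.1 < x' → x' < max p.1 q.1 →
      ∀ B₃, IsBlock (starIndices nr ×ˢ starIndices nc) B₃ → B₃ ≠ B → B₃ ≠ B' →
        (x', p.2) ∉ B₃ := by
    intro x' hx1 hx2 B₃ hB₃ hn hn' hmem
    have h : (x' + 7) / 20 = (p.1 + 7) / 20 ∨ (x' + 7) / 20 = (q.1 + 7) / 20 := by omega
    rcases h with h | h
    · exact hn (hB.eq_of_segment_eq hB₃ hp hmem h rfl).symm
    · exact hn' (hB'.eq_of_segment_eq hB₃ hq hmem h h₁.symm).symm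
  refine ⟨p.2, min p.1 q.1, max p.1 q.1, by omega, ?_, key⟩
  rcases le_total p.1 q.1 with h | h
  · rw [min_eq_left h, max_eq_right h]
    exact .inl ⟨hp, hq'⟩
  · rw [min_eq_right h, max_eq_left h]
    exact .inr ⟨hq', hp⟩

theorem MPath.singleton (s : ℕ × ℕ) : MPath [s] s s :=
  ⟨by simp, by simp, by simp, List.IsChain.singleton _⟩

theorem MPath.append {π π' : List (ℕ × ℕ)} {s t s' t' : ℕ × ℕ} (h : MPath π s t)
    (h' : MPath π' s' t') (hst : MStep t s') : MPath (π ++ π') s t' := by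
  obtain ⟨h1, h2, h3, h4⟩ := h
  obtain ⟨h1', h2', h3', h4'⟩ := h'
  refine ⟨by simp [h1], by simp [h2], by simp [h3'], ?_⟩
  refine List.isChain_append.2 ⟨h4, h4', ?_⟩
  intro x hx y hy
  rw [h3] at hx
  rw [h2'] at hy
  cases hx
  cases hy
  exact hst

theorem vcost_append (w : ℕ × ℕ → ℝ) (π π' : List (ℕ × ℕ)) :
    vcost w (π ++ π') = vcost w π + vcost w π' := by
  simp [vcost]

/-- A potential that decreases along every step by at most the weight paid bounds path costs
from below. -/
theorem MPath.le_vcost {w φ : ℕ × ℕ → ℝ} {π : List (ℕ × ℕ)} {s t : ℕ × ℕ} (h : MPath π s t)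
    (hstep : ∀ p q, MStep p q → φ p ≤ w p + φ q) (ht : φ t ≤ w t) : φ s ≤ vcost w π := by
  induction π generalizing s with
  | nil => exact absurd rfl h.1
  | cons a l ih =>
    obtain ⟨-, h2, h3, h4⟩ := h
    obtain rfl : a = s := by simpa using h2
    cases l with
    | nil =>
      obtain rfl : a = t := by simpa using h3
      simpa [vcost] using ht
    | cons a' l =>
      obtain ⟨h5, h6⟩ := List.isChain_cons_cons.1 h4
      have := ih (s := a') ⟨by simp, by simp, by simpa using h3, h6⟩
      have := hstep a a' h5
      simp only [vcost, List.map_cons, List.sum_cons] at *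
      linarith

/-- A rectangle of zero weights is crossed at zero cost. -/
theorem exists_mpath_vcost_eq_zero {w : ℕ × ℕ → ℝ} {s t : ℕ × ℕ} (h₁ : s.1 ≤ t.1) (h₂ : s.2 ≤ t.2)
    (hw : ∀ p : ℕ × ℕ, s.1 ≤ p.1 → p.1 ≤ t.1 → s.2 ≤ p.2 → p.2 ≤ t.2 → w p = 0) :
    ∃ π, MPath π s t ∧ vcost w π = 0 := by
  obtain ⟨x, y⟩ := s
  obtain ⟨x', y'⟩ := t
  dsimp only at *
  induction h₁ with
  | refl =>
    induction h₂ with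
    | refl => exact ⟨_, MPath.singleton _, by simpa [vcost] using hw (x, y) (by simp) (by simp)⟩
    | @step m hm ih =>
      obtain ⟨π, h, h0⟩ := ih fun p a b c d => hw p a b c (by omega)
      refine ⟨_, h.append (MPath.singleton (x, m + 1)) (.inr (.inl ⟨rfl, rfl⟩)), ?_⟩
      rw [vcost_append, h0]
      simpa [vcost] using hw (x, m + 1) (by simp) (by simp) (Nat.le_succ_of_le hm) (by simp)
  | @step m hm ih =>
    obtain ⟨π, h, h0⟩ := ih fun p a b c d => hw p a (by omega) c d
    refine ⟨_, h.append (MPath.singleton (m + 1, y')) (.inl ⟨rfl, rfl⟩), ?_⟩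
    rw [vcost_append, h0]
    simpa [vcost] using hw (m + 1, y') (Nat.le_succ_of_le hm) (by simp) (by simpa using h₂) (by simp)

/-- Vertices of the two-by-two array of blocks around a gadget with corner `(X, Y)` that are
neither orange nor on the diagonal of the gadget. -/
def IsHeavy (X Y : ℕ) (p : ℕ × ℕ) : Prop :=
  (X ≤ p.1 + 7 ∧ p.1 ≤ X + 28 ∧ Y ≤ p.2 + 7 ∧ p.2 ≤ Y + 28) ∧
    (X + 9 ≤ p.1 ∧ p.1 ≤ X + 12 ∨ Y + 9 ≤ p.2 ∧ p.2 ≤ Y + 12) ∧ p.1 + Y ≠ p.2 + X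

open Classical in
/-- A lower bound for the remaining cost of a path that has to cross the gadget. -/
noncomputable def gadgetPotential (w : ℕ × ℕ → ℝ) (T : ℝ) (X Y : ℕ) (p : ℕ × ℕ) : ℝ :=
  if (X ≤ p.1 + 7 ∧ p.1 ≤ X + 8 ∧ Y ≤ p.2 + 7 ∧ p.2 ≤ Y + 8) ∨ IsHeavy X Y p ∨
    (p.1 = X + 9 ∧ p.2 = Y + 9) then T
  else if p.1 = X + 10 ∧ p.2 = Y + 10 then
    min T (w (X + 10, Y + 10) + (w (X + 11, Y + 11) + w (X + 12, Y + 12)))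
  else if p.1 = X + 11 ∧ p.2 = Y + 11 then min T (w (X + 11, Y + 11) + w (X + 12, Y + 12))
  else if p.1 = X + 12 ∧ p.2 = Y + 12 then min T (w (X + 12, Y + 12))
  else 0

theorem gadgetPotential_nonneg {w : ℕ × ℕ → ℝ} {T : ℝ} (hT : 0 ≤ T) (hw : ∀ p, 0 ≤ w p)
    (X Y : ℕ) (p : ℕ × ℕ) : 0 ≤ gadgetPotential w T X Y p := by
  have h1 := hw (X + 10, Y + 10)
  have h2 := hw (X + 11, Y + 11)
  have h3 := hw (X + 12, Y + 12)
  unfold gadgetPotential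
  split_ifs
  · exact hT
  · exact le_min hT (by linarith)
  · exact le_min hT (by linarith)
  · exact le_min hT h3
  · exact le_rfl

theorem gadgetPotential_le_add {w : ℕ × ℕ → ℝ} {T : ℝ} {X Y : ℕ} (hT : 0 ≤ T)
    (hw : ∀ p, 0 ≤ w p) (hheavy : ∀ p, IsHeavy X Y p → T ≤ w p)
    (hsum : T ≤ w (X + 9, Y + 9) + (w (X + 10, Y + 10) +
      (w (X + 11, Y + 11) + w (X + 12, Y + 12)))) {p q : ℕ × ℕ} (hpq : MStep p q) :
    gadgetPotential w T X Y p ≤ w p + gadgetPotential w T X Y q := by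
  have hq := gadgetPotential_nonneg hT hw X Y q
  have h0 := hw p
  have h9 := hw (X + 9, Y + 9)
  by_cases hp : IsHeavy X Y p
  · rw [gadgetPotential, if_pos (.inr (.inl hp))]
    linarith [hheavy p hp]
  by_cases hq' : (X ≤ q.1 + 7 ∧ q.1 ≤ X + 8 ∧ Y ≤ q.2 + 7 ∧ q.2 ≤ Y + 8) ∨ IsHeavy X Y q ∨
    (q.1 = X + 9 ∧ q.2 = Y + 9)
  · rw [gadgetPotential.eq_def w T X Y q, if_pos hq']
    have : gadgetPotential w T X Y p ≤ T := by
      unfold gadgetPotential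
      split_ifs <;> first | exact le_rfl | exact min_le_left _ _ | exact hT
    linarith
  obtain ⟨x, y⟩ := p
  obtain ⟨x', y'⟩ := q
  simp only [IsHeavy, MStep] at *
  have hp1 : ¬ (X ≤ x + 7 ∧ x ≤ X + 8 ∧ Y ≤ y + 7 ∧ y ≤ Y + 8) := by omega
  by_cases hd : x + Y = y + X ∧ X + 9 ≤ x ∧ x ≤ X + 12
  · obtain ⟨k, hk⟩ := Nat.exists_eq_add_of_le hd.2.1
    obtain rfl : y = Y + 9 + k := by omega
    subst hk
    have hk : k ≤ 3 := by omega
    obtain ⟨rfl, rfl⟩ : x' = X + 9 + k + 1 ∧ y' = Y + 9 + k + 1 := by omega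
    have e9 : gadgetPotential w T X Y (X + 9, Y + 9) = T := by simp [gadgetPotential]
    have e10 : gadgetPotential w T X Y (X + 10, Y + 10) =
        min T (w (X + 10, Y + 10) + (w (X + 11, Y + 11) + w (X + 12, Y + 12))) := by
      rw [gadgetPotential, if_neg, if_pos ⟨rfl, rfl⟩]
      all_goals try simp only [IsHeavy]
      all_goals omega
    have e11 : gadgetPotential w T X Y (X + 11, Y + 11) =
        min T (w (X + 11, Y + 11) + w (X + 12, Y + 12)) := by
      rw [gadgetPotential, if_neg, if_neg, if_pos ⟨rfl, rfl⟩]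
      all_goals try simp only [IsHeavy]
      all_goals omega
    have e12 : gadgetPotential w T X Y (X + 12, Y + 12) = min T (w (X + 12, Y + 12)) := by
      rw [gadgetPotential, if_neg, if_neg, if_neg, if_pos ⟨rfl, rfl⟩]
      all_goals try simp only [IsHeavy]
      all_goals omega
    have hmin : ∀ a s : ℝ, 0 ≤ a → min T (a + s) ≤ a + min T s := fun a s ha => by
      rw [← min_add_add_left]
      exact min_le_min_right _ (by linarith)
    interval_cases k
    · change gadgetPotential w T X Y (X + 9, Y + 9) ≤
        w (X + 9, Y + 9) + gadgetPotential w T X Y (X + 10, Y + 10)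
      rw [e9, e10]
      exact (le_min le_rfl hsum).trans (hmin _ _ h9)
    · change gadgetPotential w T X Y (X + 10, Y + 10) ≤
        w (X + 10, Y + 10) + gadgetPotential w T X Y (X + 11, Y + 11)
      rw [e10, e11]
      exact hmin _ _ (hw _)
    · change gadgetPotential w T X Y (X + 11, Y + 11) ≤
        w (X + 11, Y + 11) + gadgetPotential w T X Y (X + 12, Y + 12)
      rw [e11, e12]
      exact hmin _ _ (hw _)
    · change gadgetPotential w T X Y (X + 12, Y + 12) ≤
        w (X + 12, Y + 12) + gadgetPotential w T X Y _
      rw [e12]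
      exact (min_le_right _ _).trans (by linarith)
  · rw [gadgetPotential, if_neg, if_neg, if_neg, if_neg]
    · linarith
    all_goals try simp only [IsHeavy]
    all_goals omega

/-- Any path between the two diagonal blocks around a gadget costs at least `T`, if the diagonal
of the gadget and all heavy vertices do. -/
theorem MPath.le_vcost_gadget {w : ℕ × ℕ → ℝ} {T : ℝ} {X Y : ℕ} (hT : 0 ≤ T)
    (hw : ∀ p, 0 ≤ w p) (hheavy : ∀ p, IsHeavy X Y p → T ≤ w p)
    (hsum : T ≤ w (X + 9, Y + 9) + (w (X + 10, Y + 10) +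
      (w (X + 11, Y + 11) + w (X + 12, Y + 12)))) {π : List (ℕ × ℕ)} {u v : ℕ × ℕ}
    (hu : X ≤ u.1 + 7 ∧ u.1 ≤ X + 8 ∧ Y ≤ u.2 + 7 ∧ u.2 ≤ Y + 8)
    (hv : X + 13 ≤ v.1 ∧ Y + 13 ≤ v.2) (h : MPath π u v) : T ≤ vcost w π := by
  have := h.le_vcost (φ := gadgetPotential w T X Y)
    (fun p q hpq => gadgetPotential_le_add hT hw hheavy hsum hpq) ?_
  · rwa [gadgetPotential, if_pos (.inl hu)] at this
  · rw [gadgetPotential, if_neg, if_neg, if_neg, if_neg]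
    · exact hw v
    all_goals try simp only [IsHeavy]
    all_goals omega

theorem exists_mpath_gadget {w : ℕ × ℕ → ℝ} {X Y : ℕ} {u v : ℕ × ℕ}
    (hu : u.1 ≤ X + 8 ∧ u.2 ≤ Y + 8) (hv : X + 13 ≤ v.1 ∧ Y + 13 ≤ v.2)
    (hw₁ : ∀ p : ℕ × ℕ, u.1 ≤ p.1 → p.1 ≤ X + 8 → u.2 ≤ p.2 → p.2 ≤ Y + 8 → w p = 0)
    (hw₂ : ∀ p : ℕ × ℕ, X + 13 ≤ p.1 → p.1 ≤ v.1 → Y + 13 ≤ p.2 → p.2 ≤ v.2 → w p = 0) :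
    ∃ π, MPath π u v ∧ w (X + 9, Y + 9) + (w (X + 10, Y + 10) +
      (w (X + 11, Y + 11) + w (X + 12, Y + 12))) = vcost w π := by
  obtain ⟨π, hπ, h0⟩ := exists_mpath_vcost_eq_zero (t := (X + 8, Y + 8)) hu.1 hu.2 hw₁
  obtain ⟨π', hπ', h0'⟩ := exists_mpath_vcost_eq_zero (s := (X + 13, Y + 13)) hv.1 hv.2 hw₂
  have hd : ∀ k, MStep (X + k, Y + k) (X + (k + 1), Y + (k + 1)) :=
    fun k => .inr (.inr ⟨rfl, rfl⟩)
  refine ⟨_, hπ.append ((MPath.singleton (X + 9, Y + 9)).append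
    ((MPath.singleton (X + 10, Y + 10)).append ((MPath.singleton (X + 11, Y + 11)).append
    ((MPath.singleton (X + 12, Y + 12)).append hπ' (hd 12)) (hd 11)) (hd 10)) (hd 9)) (hd 8), ?_⟩
  simp only [vcost_append, h0, h0']
  simp [vcost]

/-- Heavy vertices cost at least `U⁴ / 2`. -/
theorem IsHeavy.le_weight {U : ℕ} {r d c b : ℕ → ℕ} {i j : ℕ} (hr : 100 * (1 + r i) ≤ U)
    (hd : 100 * (1 + d i) ≤ U) (hc : 100 * (1 + c j) ≤ U) {p : ℕ × ℕ}
    (hp : IsHeavy (20 * i) (20 * j) p) : (U : ℝ) ^ 4 / 2 ≤ |Pcur U r d p.1 - Qcur U c b p.2| := by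
  obtain ⟨⟨h1, h2, h3, h4⟩, h5, h6⟩ := hp
  have hU : (1 : ℝ) ≤ U := by exact_mod_cast (by omega : 1 ≤ U)
  have h45 : (U : ℝ) ^ 4 ≤ (U : ℝ) ^ 5 := pow_le_pow_right₀ hU (by norm_num)
  have hU4 : (0 : ℝ) ≤ (U : ℝ) ^ 4 := by positivity
  by_cases hx : 20 * i + 9 ≤ p.1 ∧ p.1 ≤ 20 * i + 12
  · obtain ⟨o, ho⟩ : ∃ o, p.1 = 20 * i + (o + 1) := ⟨p.1 - 20 * i - 1, by omega⟩
    rw [ho, Pcur_add _ _ _ _ (by omega)]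
    by_cases hy : 20 * j + 9 ≤ p.2 ∧ p.2 ≤ 20 * j + 12
    · obtain ⟨o', ho'⟩ : ∃ o, p.2 = 20 * j + (o + 1) := ⟨p.2 - 20 * j - 1, by omega⟩
      rw [ho', Qcur_add _ _ _ _ (by omega)]
      have ha := abs_le.1 (abs_alphaVal_sub_le (o := o) hr hd (by omega) (by omega))
      have hb := abs_le.1 (abs_betaVal_sub_le (b := b) (o := o') hc (by omega) (by omega))
      rcases lt_or_gt_of_ne (by omega : o ≠ o') with hlt | hlt
      · have : (o : ℝ) + 1 ≤ o' := by exact_mod_cast hlt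
        rw [abs_sub_comm]
        exact le_trans (by nlinarith) (le_abs_self _)
      · have : (o' : ℝ) + 1 ≤ o := by exact_mod_cast hlt
        exact le_trans (by nlinarith) (le_abs_self _)
    · have := alphaVal_nonneg (o := o) hr hd (by omega) (by omega)
      rw [Qcur, betaVal_of_star _ _ _ _ (by omega), starPt]
      exact le_trans (by linarith) (le_abs_self _)
  · obtain ⟨o, ho⟩ : ∃ o, p.2 = 20 * j + (o + 1) := ⟨p.2 - 20 * j - 1, by omega⟩
    have := betaVal_nonneg (b := b) (o := o) hc (by omega) (by omega)
    rw [ho, Qcur_add _ _ _ _ (by omega), Pcur, alphaVal_of_star _ _ _ _ (by omega), starPt,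
      abs_sub_comm]
    exact le_trans (by linarith) (le_abs_self _)

/-- If `r_i ≠ c_j`, the first diagonal vertex of the gadget is already expensive. -/
theorem add_one_le_abs_alphaVal_sub_betaVal {U : ℕ} {r d c b : ℕ → ℕ} {i j : ℕ}
    (hd : 100 * (1 + d i) ≤ U) (hne : r i ≠ c j) :
    (U : ℝ) ^ 3 + 1 ≤ |alphaVal U r d i 8 - betaVal U c b j 8| := by
  have hd' : 100 * (1 + (d i : ℝ)) ≤ U := by exact_mod_cast hd
  have hd0 : (0 : ℝ) ≤ d i := by positivity
  have hU : (100 : ℝ) ≤ U := by linarith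
  have h3 : 10000 * (U : ℝ) ≤ (U : ℝ) ^ 3 := by
    calc 10000 * (U : ℝ) = 100 ^ 2 * U := by norm_num
      _ ≤ (U : ℝ) ^ 2 * U := by gcongr
      _ = _ := by ring
  simp only [alphaVal, betaVal, if_true]
  rcases lt_or_gt_of_ne hne with h | h
  · have h' : (r i : ℝ) + 1 ≤ c j := by exact_mod_cast h
    rw [abs_sub_comm]
    exact le_trans (by nlinarith) (le_abs_self _)
  · have h' : (c j : ℝ) + 1 ≤ r i := by exact_mod_cast h
    exact le_trans (by nlinarith) (le_abs_self _)

/-- If `r_i = c_j`, the diagonal of the gadget costs `4U + d_i b_j`. -/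
theorem sum_abs_alphaVal_sub_betaVal {U : ℕ} {r d c b : ℕ → ℕ} {i j : ℕ}
    (hd : 100 * (1 + d i) ≤ U) (hb : b j ≤ 1) (heq : r i = c j) :
    |alphaVal U r d i 8 - betaVal U c b j 8| + (|alphaVal U r d i 9 - betaVal U c b j 9| +
      (|alphaVal U r d i 10 - betaVal U c b j 10| + |alphaVal U r d i 11 - betaVal U c b j 11|)) =
      4 * (U : ℝ) + ((d i * b j : ℕ) : ℝ) := by
  have hd' : 100 * (1 + (d i : ℝ)) ≤ U := by exact_mod_cast hd
  have hd0 : (0 : ℝ) ≤ d i := by positivity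
  have e8 : alphaVal U r d i 8 - betaVal U c b j 8 = d i / 4 + U := by
    simp [alphaVal, betaVal, heq]
  have e9 : alphaVal U r d i 9 - betaVal U c b j 9 = -(d i / 4 + U) := by
    simp [alphaVal, betaVal, heq]
    ring
  have e10 : alphaVal U r d i 10 - betaVal U c b j 10 = d i / 4 - (-1) ^ b j * U := by
    simp [alphaVal, betaVal, heq]
  have e11 : alphaVal U r d i 11 - betaVal U c b j 11 = -(d i / 4 - (-1) ^ b j * U) := by
    simp [alphaVal, betaVal, heq]
  rw [e8, e9, e10, e11, abs_neg, abs_neg, abs_of_nonneg (by linarith : (0 : ℝ) ≤ d i / 4 + U)]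
  obtain hb | hb : b j = 0 ∨ b j = 1 := by omega
  · rw [hb, abs_of_nonpos (by norm_num; linarith)]
    push_cast
    ring
  · rw [hb, abs_of_nonneg (by norm_num; linarith)]
    push_cast
    ring

/-- The two values compared with the diagonal cost are dominated by the weights of heavy
vertices. -/
theorem le_pow_four_div_two {U m : ℕ} (hm : 100 * (1 + m) ≤ U) :
    (U : ℝ) ^ 3 + 1 ≤ (U : ℝ) ^ 4 / 2 ∧ 4 * (U : ℝ) + m ≤ (U : ℝ) ^ 4 / 2 := by
  have hm' : 100 * (1 + (m : ℝ)) ≤ U := by exact_mod_cast hm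
  have hm0 : (0 : ℝ) ≤ m := by positivity
  have hU : (100 : ℝ) ≤ U := by linarith
  have h3 : 10000 * (U : ℝ) ≤ (U : ℝ) ^ 3 := by
    calc 10000 * (U : ℝ) = 100 ^ 2 * U := by norm_num
      _ ≤ (U : ℝ) ^ 2 * U := by gcongr
      _ = _ := by ring
  have h4 : 100 * (U : ℝ) ^ 3 ≤ (U : ℝ) ^ 4 := by
    calc 100 * (U : ℝ) ^ 3 ≤ U * (U : ℝ) ^ 3 := by gcongr
      _ = _ := by ring
  constructor <;> linarith

/-- Positions of two vertices `u ≤ v` of diagonally adjacent blocks relative to the gadget that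
meets both blocks. -/
theorem DiagAdj.position {nr nc : ℕ} {B₁ B₂ : Set (ℕ × ℕ)}
    (hB₁ : IsBlock (starIndices nr ×ˢ starIndices nc) B₁)
    (hB₂ : IsBlock (starIndices nr ×ˢ starIndices nc) B₂) (hne : B₁ ≠ B₂)
    (hadj : DiagAdj (starIndices nr ×ˢ starIndices nc) B₁ B₂) {i j : ℕ}
    (hint₁ : ∃ v ∈ B₁, v ∈ Gadget i j) (hint₂ : ∃ v ∈ B₂, v ∈ Gadget i j) {u v : ℕ × ℕ}
    (hu : u ∈ B₁) (hv : v ∈ B₂) (hx : u.1 ≤ v.1) (hy : u.2 ≤ v.2) :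
    (20 * i ≤ u.1 + 7 ∧ u.1 ≤ 20 * i + 8 ∧ 20 * j ≤ u.2 + 7 ∧ u.2 ≤ 20 * j + 8) ∧
      20 * i + 13 ≤ v.1 ∧ v.1 ≤ 20 * i + 28 ∧ 20 * j + 13 ≤ v.2 ∧ v.2 ≤ 20 * j + 28 := by
  obtain ⟨p, hp, hp1, hp2, hpi, hpj⟩ := hint₁
  obtain ⟨q, hq, hq1, hq2, hqi, hqj⟩ := hint₂
  have hrow : (q.1 + 7) / 20 ≠ (p.1 + 7) / 20 := fun h =>
    hadj.1 (hB₁.horizAdj hB₂ hp hq hne h (hqj.trans hpj.symm))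
  have hcol : (q.2 + 7) / 20 ≠ (p.2 + 7) / 20 := fun h =>
    hadj.2.1 (hB₁.vertAdj hB₂ hp hq hne h (hqi.trans hpi.symm))
  obtain ⟨⟨huO, huO'⟩, hu, hu'⟩ := (hB₁.mem_iff hp _).1 hu
  obtain ⟨⟨hvO, hvO'⟩, hv, hv'⟩ := (hB₂.mem_iff hq _).1 hv
  rw [mem_starIndices] at huO huO' hvO hvO'
  clear hadj
  have h₁ : 20 * i ≤ u.1 + 7 ∧ u.1 ≤ 20 * i + 8 ∧ 20 * i + 13 ≤ v.1 ∧ v.1 ≤ 20 * i + 28 := by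
    clear hcol huO' hvO' hu' hv' hpj hqj hy
    omega
  have h₂ : 20 * j ≤ u.2 + 7 ∧ u.2 ≤ 20 * j + 8 ∧ 20 * j + 13 ≤ v.2 ∧ v.2 ≤ 20 * j + 28 := by
    clear hrow huO hvO hu hv hpi hqi hx h₁
    omega
  exact ⟨⟨h₁.1, h₁.2.1, h₂.1, h₂.2.1⟩, h₁.2.2.1, h₁.2.2.2, h₂.2.2.1, h₂.2.2.2⟩

/-- The size condition on `U` makes it large compared with each parameter. -/
theorem parameters_le {nr nc D R C U : ℕ} (hnr : 1 ≤ nr) (hnc : 1 ≤ nc)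
    (hU : 100 * nr * nc * (1 + D) ^ 2 * (1 + R) ^ 2 * (1 + C) ^ 2 < U) :
    100 * (1 + D) ≤ U ∧ 100 * (1 + R) ≤ U ∧ 100 * (1 + C) ≤ U := by
  have hdvd : ∀ A, A ∣ 100 * nr * nc * (1 + D) ^ 2 * (1 + R) ^ 2 * (1 + C) ^ 2 → A ≤ U :=
    fun A h => (Nat.le_of_dvd (by positivity) h).trans hU.le
  exact ⟨hdvd _ ⟨nr * nc * (1 + D) * (1 + R) ^ 2 * (1 + C) ^ 2, by ring⟩,
    hdvd _ ⟨nr * nc * (1 + D) ^ 2 * (1 + R) * (1 + C) ^ 2, by ring⟩,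
    hdvd _ ⟨nr * nc * (1 + D) ^ 2 * (1 + R) ^ 2 * (1 + C), by ring⟩⟩

/-- In the DTW lower-bound construction, let `B₁` and `B₂` be
two blocks that are diagonally adjacent, and let `R_{ij}` be the gadget that
intersects both. Then for every `u ∈ B₁` and `v ∈ B₂` with `u ≤ v`
componentwise: if `r_i ≠ c_j` the minimum cost of an xy-monotone path from `u`
to `v` is strictly greater than `U³`, and if `r_i = c_j` it equals
`4U + d_i·b_j`. -/
theorem stmt6 (nr nc : ℕ) (hnr : 1 ≤ nr) (hnc : 1 ≤ nc)
    (r d : ℕ → ℕ) (c b : ℕ → ℕ) (hb : ∀ j, b j ≤ 1) (U : ℕ)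
    (hU : 100 * nr * nc * (1 + (Finset.range nr).sup d) ^ 2
        * (1 + (Finset.range nr).sup r) ^ 2
        * (1 + (Finset.range nc).sup c) ^ 2 < U)
    (B₁ B₂ : Set (ℕ × ℕ))
    (hB₁ : IsBlock (orangeSet nr nc U r d c b) B₁)
    (hB₂ : IsBlock (orangeSet nr nc U r d c b) B₂)
    (hne : B₁ ≠ B₂)
    (hadj : DiagAdj (orangeSet nr nc U r d c b) B₁ B₂)
    (i j : ℕ) (hi : i < nr) (hj : j < nc)
    (hint₁ : ∃ v ∈ B₁, v ∈ Gadget i j) (hint₂ : ∃ v ∈ B₂, v ∈ Gadget i j)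
    (ux uy vx vy : ℕ) (hu : (ux, uy) ∈ B₁) (hv : (vx, vy) ∈ B₂)
    (hx : ux ≤ vx) (hy : uy ≤ vy) :
    (r i ≠ c j →
      (U : ℝ) ^ 3 < sInf {t : ℝ | ∃ π : List (ℕ × ℕ), MPath π (ux, uy) (vx, vy) ∧
        t = vcost (fun v => |Pcur U r d v.1 - Qcur U c b v.2|) π}) ∧
    (r i = c j →
      sInf {t : ℝ | ∃ π : List (ℕ × ℕ), MPath π (ux, uy) (vx, vy) ∧
        t = vcost (fun v => |Pcur U r d v.1 - Qcur U c b v.2|) π}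
      = 4 * (U : ℝ) + ((d i * b j : ℕ) : ℝ)) := by
  obtain ⟨hD, hR, hC⟩ := parameters_le hnr hnc hU
  have hd : ∀ i < nr, 100 * (1 + d i) ≤ U := fun i hi =>
    le_trans (by gcongr; exact Finset.le_sup (Finset.mem_range.2 hi)) hD
  have hr : ∀ i < nr, 100 * (1 + r i) ≤ U := fun i hi =>
    le_trans (by gcongr; exact Finset.le_sup (Finset.mem_range.2 hi)) hR
  have hc : ∀ j < nc, 100 * (1 + c j) ≤ U := fun j hj =>
    le_trans (by gcongr; exact Finset.le_sup (Finset.mem_range.2 hj)) hC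
  rw [orangeSet_eq (by omega) hr hd hc] at hB₁ hB₂ hadj
  obtain ⟨hu', hv'⟩ := DiagAdj.position hB₁ hB₂ hne hadj hint₁ hint₂ hu hv hx hy
  clear hadj hU hD hR hC
  set w : ℕ × ℕ → ℝ := fun v => |Pcur U r d v.1 - Qcur U c b v.2| with hw
  have hw0 : ∀ p, 0 ≤ w p := fun p => abs_nonneg _
  have hheavy : ∀ p, IsHeavy (20 * i) (20 * j) p → (U : ℝ) ^ 4 / 2 ≤ w p :=
    fun p h => h.le_weight (hr i hi) (hd i hi) (hc j hj)
  have hdiag : ∀ o < 20, w (20 * i + (o + 1), 20 * j + (o + 1)) =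
      |alphaVal U r d i o - betaVal U c b j o| := fun o ho => by
    simp only [hw, Pcur_add U r d i ho, Qcur_add U c b j ho]
  have h8 := hdiag 8 (by norm_num)
  have h9 := hdiag 9 (by norm_num)
  have h10 := hdiag 10 (by norm_num)
  have h11 := hdiag 11 (by norm_num)
  norm_num at h8 h9 h10 h11
  have hstar : ∀ p : ℕ × ℕ, (ux ≤ p.1 ∧ p.1 ≤ 20 * i + 8 ∨ 20 * i + 13 ≤ p.1 ∧ p.1 ≤ vx) →
      (uy ≤ p.2 ∧ p.2 ≤ 20 * j + 8 ∨ 20 * j + 13 ≤ p.2 ∧ p.2 ≤ vy) → w p = 0 := fun p hx hy => by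
    simp only [hw, Pcur, Qcur]
    rw [alphaVal_of_star _ _ _ _ (by omega), betaVal_of_star _ _ _ _ (by omega), sub_self, abs_zero]
  obtain ⟨π, hπ, hcost⟩ := exists_mpath_gadget (w := w) (X := 20 * i) (Y := 20 * j)
    (u := (ux, uy)) (v := (vx, vy)) ⟨hu'.2.1, hu'.2.2.2⟩ ⟨hv'.1, hv'.2.2.1⟩
    (fun p a b c d => hstar p (.inl ⟨a, b⟩) (.inl ⟨c, d⟩))
    (fun p a b c d => hstar p (.inr ⟨a, b⟩) (.inr ⟨c, d⟩))
  have hlower : ∀ T : ℝ, 0 ≤ T → T ≤ (U : ℝ) ^ 4 / 2 → T ≤ w (20 * i + 9, 20 * j + 9) +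
      (w (20 * i + 10, 20 * j + 10) + (w (20 * i + 11, 20 * j + 11) +
        w (20 * i + 12, 20 * j + 12))) →
      ∀ π, MPath π (ux, uy) (vx, vy) → T ≤ vcost w π := fun T h0 h1 h2 π hπ =>
    hπ.le_vcost_gadget (X := 20 * i) (Y := 20 * j) h0 hw0 (fun p hp => h1.trans (hheavy p hp)) h2 hu'
      ⟨hv'.1, hv'.2.2.1⟩
  obtain ⟨hT₁, hT₂⟩ := le_pow_four_div_two (hd i hi)
  refine ⟨fun hne => ?_, fun heq => ?_⟩
  · refine lt_of_lt_of_le (lt_add_one _) (le_csInf ⟨_, π, hπ, rfl⟩ ?_)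
    rintro _ ⟨π', hπ', rfl⟩
    refine hlower _ (by positivity) hT₁ ?_ π' hπ'
    rw [h8]
    exact (add_one_le_abs_alphaVal_sub_betaVal (hd i hi) hne).trans (le_add_of_nonneg_right
      (add_nonneg (hw0 _) (add_nonneg (hw0 _) (hw0 _))))
  · have hsum := sum_abs_alphaVal_sub_betaVal (hd i hi) (hb j) heq
    rw [← h8, ← h9, ← h10, ← h11] at hsum
    have hdb : ((d i * b j : ℕ) : ℝ) ≤ d i := by
      exact_mod_cast mul_le_of_le_one_right (Nat.zero_le _) (hb j)
    refine IsLeast.csInf_eq ⟨⟨π, hπ, hsum.symm.trans hcost⟩, ?_⟩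
    rintro _ ⟨π', hπ', rfl⟩
    exact hlower _ (by positivity) (le_trans (by gcongr) hT₂) hsum.ge π' hπ'
end

section
/- In the DTW lower-bound construction, let L be the minimum weight of a directed path from (0,0) to (n_r, n_c) in the directed grid on vertices {0,…,n_r}×{0,…,n_c} whose horizontal arcs (i,j)→(i,j+1) and vertical arcs (i,j)→(i+1,j) have weight U and whose diagonal arcs (i,j)→(i+1,j+1) (for 0 ≤ i < n_r, 0 ≤ j < n_c) have weight d_i·b_j if r_i = c_j and weight √U otherwise. Then: (i) L < |n_r − n_c|·U + √U holds if and only if DTW(P,Q) < |n_r − n_c|·(4U⁵ + 10U⁴) + U³; and (ii) when these inequalities hold, DTW(P,Q) = L − |n_r − n_c|·U + |n_r − n_c|·(4U⁵ + 10U⁴) + 4·min{n_r, n_c}·U. -/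
/-- Cost of a path in an arc-weighted directed grid: sum of the weights of its
arcs. -/
noncomputable def acost (w : ℕ × ℕ → ℕ × ℕ → ℝ) (π : List (ℕ × ℕ)) : ℝ :=
  ((π.zip π.tail).map fun p => w p.1 p.2).sum

/-- Arc weights of the Intermediary-style directed grid: horizontal arcs
`(i,j)→(i,j+1)` and vertical arcs `(i,j)→(i+1,j)` have weight `U`; the diagonal
arc `(i,j)→(i+1,j+1)` has weight `d_i·b_j` if `r_i = c_j` and `√U` otherwise. -/
noncomputable def interW (r c d b : ℕ → ℕ) (U : ℕ) (u v : ℕ × ℕ) : ℝ :=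
  if v = (u.1 + 1, u.2 + 1) then
    (if r u.1 = c u.2 then ((d u.1 * b u.2 : ℕ) : ℝ) else Real.sqrt U)
  else (U : ℝ)

/-- `GridWalk w s t C`: some xy-monotone path from `s` to `t` has total arc weight `C`. -/
inductive GridWalk (w : ℕ × ℕ → ℕ × ℕ → ℝ) : ℕ × ℕ → ℕ × ℕ → ℝ → Prop
  | refl (s : ℕ × ℕ) : GridWalk w s s 0
  | head {s u t : ℕ × ℕ} {C : ℝ} : MStep s u → GridWalk w u t C → GridWalk w s t (w s u + C)

namespace GridWalk

variable {w w' : ℕ × ℕ → ℕ × ℕ → ℝ} {s u t : ℕ × ℕ} {C C' : ℝ}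

theorem trans (h : GridWalk w s u C) (h' : GridWalk w u t C') : GridWalk w s t (C + C') := by
  induction h with
  | refl => simpa using h'
  | head hs _ ih => simpa [add_assoc] using head hs (ih h')

theorem single (h : MStep s t) : GridWalk w s t (w s t) := by
  simpa using head h (refl (w := w) t)

theorem le_target (h : GridWalk w s t C) : s.1 ≤ t.1 ∧ s.2 ≤ t.2 := by
  induction h with
  | refl => simp
  | head hs _ ih => unfold MStep at hs; omega

theorem congr_weight (h : GridWalk w s t C)
    (hw : ∀ u v, MStep u v → v.1 ≤ t.1 → v.2 ≤ t.2 → w u v = w' u v) : GridWalk w' s t C := by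
  induction h with
  | refl => exact refl _
  | head hs hu ih =>
    rw [hw _ _ hs hu.le_target.1 hu.le_target.2]
    exact head hs (ih hw)

theorem nonneg (hw : ∀ u v, 0 ≤ w u v) (h : GridWalk w s t C) : 0 ≤ C := by
  induction h with
  | refl => exact le_rfl
  | head _ _ ih => exact add_nonneg (hw _ _) ih

theorem potential_le {f : ℕ × ℕ → ℝ}
    (hf : ∀ u v, s.1 ≤ u.1 → s.2 ≤ u.2 → MStep u v → f v ≤ f u + w u v)
    (h : GridWalk w s t C) : f t ≤ f s + C := by
  induction h with
  | refl => simp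
  | @head s u t C hs _ ih =>
    have hsu : s.1 ≤ u.1 ∧ s.2 ≤ u.2 := by unfold MStep at hs; omega
    have := ih fun u' v h1 h2 => hf u' v (hsu.1.trans h1) (hsu.2.trans h2)
    linarith [hf s u le_rfl le_rfl hs]

theorem diag (w : ℕ × ℕ → ℕ × ℕ → ℝ) (p q n : ℕ) : GridWalk w (p, q) (p + n, q + n)
    (∑ k ∈ Finset.range n, w (p + k, q + k) (p + k + 1, q + k + 1)) := by
  induction n with
  | zero => simpa using refl (w := w) (p, q)
  | succ n ih =>
    rw [Finset.sum_range_succ]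
    exact ih.trans (single (by simp [MStep]; omega))

theorem vert (w : ℕ × ℕ → ℕ × ℕ → ℝ) (p q n : ℕ) : GridWalk w (p, q) (p + n, q)
    (∑ k ∈ Finset.range n, w (p + k, q) (p + k + 1, q)) := by
  induction n with
  | zero => simpa using refl (w := w) (p, q)
  | succ n ih =>
    rw [Finset.sum_range_succ]
    exact ih.trans (single (by simp [MStep]; omega))

theorem horiz (w : ℕ × ℕ → ℕ × ℕ → ℝ) (p q n : ℕ) : GridWalk w (p, q) (p, q + n)
    (∑ k ∈ Finset.range n, w (p, q + k) (p, q + k + 1)) := by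
  induction n with
  | zero => simpa using refl (w := w) (p, q)
  | succ n ih =>
    rw [Finset.sum_range_succ]
    exact ih.trans (single (by simp [MStep]; omega))

end GridWalk

theorem MPath.gridWalk (w : ℕ × ℕ → ℕ × ℕ → ℝ) {t : ℕ × ℕ} :
    ∀ {π : List (ℕ × ℕ)} {s : ℕ × ℕ}, MPath π s t → GridWalk w s t (acost w π)
  | [], _, h => absurd rfl h.1
  | [x], s, ⟨_, hs, ht, _⟩ => by
    simp only [List.head?_cons, List.getLast?_singleton, Option.some.injEq] at hs ht
    subst hs ht
    simpa [acost] using GridWalk.refl (w := w) x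
  | x :: y :: l, s, ⟨_, hs, ht, hc⟩ => by
    simp only [List.head?_cons, Option.some.injEq] at hs
    subst hs
    have hc' := List.isChain_cons_cons.1 hc
    have h : MPath (y :: l) y t := ⟨by simp, by simp, by simpa using ht, hc'.2⟩
    simpa [acost] using GridWalk.head hc'.1 (h.gridWalk w)

theorem GridWalk.exists_mpath {w : ℕ × ℕ → ℕ × ℕ → ℝ} {s t : ℕ × ℕ} {C : ℝ}
    (h : GridWalk w s t C) : ∃ π, MPath π s t ∧ C = acost w π := by
  induction h with
  | refl s => exact ⟨[s], ⟨by simp, by simp, by simp, List.isChain_singleton _⟩, by simp [acost]⟩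
  | @head s u t C hs _ ih =>
    obtain ⟨π, ⟨h0, h1, h2, h3⟩, rfl⟩ := ih
    match π, h0, h1, h2, h3 with
    | y :: l, _, h1, h2, h3 =>
      simp only [List.head?_cons, Option.some.injEq] at h1
      subst h1
      exact ⟨s :: y :: l, ⟨by simp, by simp, by simpa using h2, List.isChain_cons_cons.2 ⟨hs, h3⟩⟩,
        by simp [acost]⟩

theorem setOf_acost_eq (w : ℕ × ℕ → ℕ × ℕ → ℝ) (s t : ℕ × ℕ) :
    {x : ℝ | ∃ π : List (ℕ × ℕ), MPath π s t ∧ x = acost w π} = {x | GridWalk w s t x} := by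
  ext x
  constructor
  · rintro ⟨π, hπ, rfl⟩
    exact hπ.gridWalk w
  · exact fun h => h.exists_mpath

theorem vcost_cons_eq (w : ℕ × ℕ → ℝ) (x : ℕ × ℕ) (l : List (ℕ × ℕ)) :
    vcost w (x :: l) = w x + acost (fun _ v => w v) (x :: l) := by
  induction l generalizing x with
  | nil => simp [vcost, acost]
  | cons y l ih =>
    have h := ih y
    simp only [vcost, acost, List.map_cons, List.sum_cons, List.tail_cons, List.zip_cons_cons]
      at h ⊢
    rw [h]

theorem setOf_vcost_eq (w : ℕ × ℕ → ℝ) (s t : ℕ × ℕ) (hs : w s = 0) :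
    {x : ℝ | ∃ π : List (ℕ × ℕ), MPath π s t ∧ x = vcost w π} =
      {x | GridWalk (fun _ v => w v) s t x} := by
  rw [← setOf_acost_eq]
  ext x
  refine exists_congr fun π => and_congr_right fun hπ => ?_
  match π, hπ with
  | [], hπ => exact absurd rfl hπ.1
  | y :: l, ⟨_, hy, _⟩ =>
    simp only [List.head?_cons, Option.some.injEq] at hy
    subst hy
    rw [vcost_cons_eq, hs, zero_add]

/-- Distances from `(0, 0)` in the directed grid with axis-parallel arcs of weight `X` and the
diagonal arc leaving `(i, j)` of weight `m i j`. -/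
noncomputable def gridDist (X : ℝ) (m : ℕ → ℕ → ℝ) : ℕ → ℕ → ℝ
  | 0, 0 => 0
  | 0, j + 1 => gridDist X m 0 j + X
  | i + 1, 0 => gridDist X m i 0 + X
  | i + 1, j + 1 => min (min (gridDist X m i (j + 1) + X) (gridDist X m (i + 1) j + X))
      (gridDist X m i j + m i j)

/-- The arc weights of the grid measured by `gridDist`. -/
noncomputable def gridWeight (X : ℝ) (m : ℕ → ℕ → ℝ) (u v : ℕ × ℕ) : ℝ :=
  if v = (u.1 + 1, u.2 + 1) then m u.1 u.2 else X

section GridDist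

variable {X : ℝ} {m : ℕ → ℕ → ℝ}

theorem gridWalk_gridDist (X : ℝ) (m : ℕ → ℕ → ℝ) (i j : ℕ) :
    GridWalk (gridWeight X m) (0, 0) (i, j) (gridDist X m i j) := by
  have snoc {u v : ℕ × ℕ} {C : ℝ} (h : GridWalk (gridWeight X m) (0, 0) u C) (x : ℝ)
      (hs : MStep u v) (hx : gridWeight X m u v = x) :
      GridWalk (gridWeight X m) (0, 0) v (C + x) := hx ▸ h.trans (.single hs)
  fun_induction gridDist X m i j with
  | case1 => exact .refl _
  | case2 j ih => exact snoc ih X (by simp [MStep]) (by simp [gridWeight])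
  | case3 i ih => exact snoc ih X (by simp [MStep]) (by simp [gridWeight])
  | case4 i j ih1 ih2 ih3 =>
    rcases min_choice (min (gridDist X m i (j + 1) + X) (gridDist X m (i + 1) j + X))
      (gridDist X m i j + m i j) with h | h <;> rw [h]
    · rcases min_choice (gridDist X m i (j + 1) + X) (gridDist X m (i + 1) j + X) with h | h <;>
        rw [h]
      · exact snoc ih1 X (by simp [MStep]) (by simp [gridWeight])
      · exact snoc ih2 X (by simp [MStep]) (by simp [gridWeight])
    · exact snoc ih3 (m i j) (by simp [MStep]) (by simp [gridWeight])

theorem gridDist_succ_left_le (i j : ℕ) : gridDist X m (i + 1) j ≤ gridDist X m i j + X := by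
  cases j <;> simp [gridDist]

theorem gridDist_succ_right_le (i j : ℕ) : gridDist X m i (j + 1) ≤ gridDist X m i j + X := by
  cases i <;> simp [gridDist]

theorem gridDist_succ_succ_le (i j : ℕ) :
    gridDist X m (i + 1) (j + 1) ≤ gridDist X m i j + m i j := by
  simp [gridDist]

theorem gridDist_le_succ_left (hX : 0 ≤ X) (hm : ∀ i j, 0 ≤ m i j) (i j : ℕ) :
    gridDist X m i j ≤ gridDist X m (i + 1) j + X := by
  induction j with
  | zero => rw [gridDist]; linarith
  | succ j ih =>
    have h := gridDist_succ_right_le (X := X) (m := m) i j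
    rw [gridDist, ← min_add_add_right, ← min_add_add_right]
    refine le_min (le_min ?_ ?_) ?_ <;> linarith [hm i j]

theorem gridDist_le_succ_right (hX : 0 ≤ X) (hm : ∀ i j, 0 ≤ m i j) (i j : ℕ) :
    gridDist X m i j ≤ gridDist X m i (j + 1) + X := by
  induction i with
  | zero => rw [gridDist.eq_2]; linarith
  | succ i ih =>
    have h := gridDist_succ_left_le (X := X) (m := m) i j
    rw [gridDist.eq_4, ← min_add_add_right, ← min_add_add_right]
    refine le_min (le_min ?_ ?_) ?_ <;> linarith [hm i j]

end GridDist

/-- Positions on a curve made of four-point cores separated by gaps of sixteen stars: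
`gap i s` is the star number `s` of the gap in front of core `i`, and `core i k` is the point
number `k` of core `i`. -/
inductive CurvePos
  | gap (i s : ℕ)
  | core (i k : ℕ)

namespace CurvePos

/-- `Next x y`: the position `y` directly follows the position `x` on the curve. -/
inductive Next : CurvePos → CurvePos → Prop
  | gap_gap (i s : ℕ) : Next (gap i s) (gap i (s + 1))
  | gap_core (i s : ℕ) : 15 ≤ s → Next (gap i s) (core i 0)
  | core_core (i k : ℕ) : k < 3 → Next (core i k) (core i (k + 1))
  | core_gap (i : ℕ) : Next (core i 3) (gap (i + 1) 0)

/-- Core positions have offset at most `3`. -/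
def Valid : CurvePos → Prop
  | gap _ _ => True
  | core _ k => k ≤ 3

/-- The height above `⋆` of the point at a position, where `a i k` is the height of `core i k`. -/
def height (a : ℕ → ℕ → ℝ) : CurvePos → ℝ
  | gap _ _ => 0
  | core i k => a i k

/-- Sum of the first `k + 1` entries of core `i`. -/
noncomputable def coreSum (a : ℕ → ℕ → ℝ) (i k : ℕ) : ℝ := ∑ l ∈ Finset.range (k + 1), a i l

/-- Cost of aligning the first `k + 1` entries of two cores along the diagonal. -/
noncomputable def alignSum (a b : ℕ → ℕ → ℝ) (i j k : ℕ) : ℝ :=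
  ∑ l ∈ Finset.range (k + 1), |a i l - b j l|

/-- A lower bound on the cost of a warping path ending at a given pair of positions. -/
noncomputable def potential (e X : ℝ) (m : ℕ → ℕ → ℝ) (G : ℕ → ℕ → ℝ) (a b : ℕ → ℕ → ℝ) :
    CurvePos → CurvePos → ℝ
  | gap i _, gap j _ => G i j
  | core i k, gap j t =>
    min (G i j + coreSum a i k) (G (i + 1) j - X + coreSum a i k + ((t - k : ℕ) : ℝ) * e)
  | gap i s, core j l =>
    min (G i j + coreSum b j l) (G i (j + 1) - X + coreSum b j l + ((s - l : ℕ) : ℝ) * e)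
  | core i k, core j l => G i j + if k = l then min (m i j) (alignSum a b i j k) else m i j

/-- The quantitative separation properties under which `potential` is a lower bound. -/
structure Separated (e X : ℝ) (m : ℕ → ℕ → ℝ) (G : ℕ → ℕ → ℝ) (a b : ℕ → ℕ → ℝ) : Prop where
  X_le : X ≤ 6 * e
  m_nonneg : ∀ i j, 0 ≤ m i j
  m_le_unit : ∀ i j, m i j ≤ e
  m_le_align : ∀ i j, m i j ≤ alignSum a b i j 3
  m_le_cross : ∀ i j k l, k ≤ 3 → l ≤ 3 → k ≠ l → m i j ≤ |a i k - b j l|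
  left_ge : ∀ i k, k ≤ 3 → e ≤ a i k
  right_ge : ∀ j l, l ≤ 3 → e ≤ b j l
  left_sum : ∀ i, coreSum a i 3 = X
  right_sum : ∀ j, coreSum b j 3 = X
  succ_left_le : ∀ i j, G (i + 1) j ≤ G i j + X
  succ_right_le : ∀ i j, G i (j + 1) ≤ G i j + X
  le_succ_left : ∀ i j, G i j ≤ G (i + 1) j + X
  le_succ_right : ∀ i j, G i j ≤ G i (j + 1) + X
  succ_succ_le : ∀ i j, G (i + 1) (j + 1) ≤ G i j + m i j

section Potential

variable {e X : ℝ} {m G a b : ℕ → ℕ → ℝ}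

theorem coreSum_zero (i : ℕ) : coreSum a i 0 = a i 0 := by simp [coreSum]

theorem coreSum_succ (i k : ℕ) : coreSum a i (k + 1) = coreSum a i k + a i (k + 1) := by
  simp [coreSum, Finset.sum_range_succ]

theorem alignSum_zero (i j : ℕ) : alignSum a b i j 0 = |a i 0 - b j 0| := by simp [alignSum]

theorem alignSum_succ (i j k : ℕ) :
    alignSum a b i j (k + 1) = alignSum a b i j k + |a i (k + 1) - b j (k + 1)| := by
  simp [alignSum, Finset.sum_range_succ]

theorem alignSum_nonneg (i j k : ℕ) : 0 ≤ alignSum a b i j k :=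
  Finset.sum_nonneg fun _ _ => abs_nonneg _

theorem alignSum_swap (i j k : ℕ) : alignSum b a j i k = alignSum a b i j k := by
  simp [alignSum, abs_sub_comm]

theorem potential_swap (x y : CurvePos) :
    potential e X (fun i j => m j i) (fun i j => G j i) b a y x = potential e X m G a b x y := by
  cases x <;> cases y <;> simp only [potential]
  rename_i i k j l
  by_cases hkl : k = l
  · simp [hkl, alignSum_swap]
  · simp [hkl, Ne.symm hkl]

namespace Separated

theorem swap (h : Separated e X m G a b) :
    Separated e X (fun i j => m j i) (fun i j => G j i) b a where
  X_le := h.X_le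
  m_nonneg i j := h.m_nonneg j i
  m_le_unit i j := h.m_le_unit j i
  m_le_align i j := by rw [alignSum_swap]; exact h.m_le_align j i
  m_le_cross i j k l hk hl hkl := by
    rw [abs_sub_comm]; exact h.m_le_cross j i l k hl hk hkl.symm
  left_ge := h.right_ge
  right_ge := h.left_ge
  left_sum := h.right_sum
  right_sum := h.left_sum
  succ_left_le i j := h.succ_right_le j i
  succ_right_le i j := h.succ_left_le j i
  le_succ_left i j := h.le_succ_right j i
  le_succ_right i j := h.le_succ_left j i
  succ_succ_le i j := h.succ_succ_le j i

theorem unit_nonneg (h : Separated e X m G a b) : 0 ≤ e := (h.m_nonneg 0 0).trans (h.m_le_unit 0 0)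

theorem unit_le_coreSum (h : Separated e X m G a b) (i : ℕ) {k : ℕ} (hk : k ≤ 3) :
    e ≤ coreSum a i k := by
  induction k with
  | zero => rw [coreSum_zero]; exact h.left_ge i 0 hk
  | succ k ih => rw [coreSum_succ]; linarith [ih (by omega), h.left_ge i _ hk, h.unit_nonneg]

theorem coreSum_le (h : Separated e X m G a b) (i : ℕ) {k : ℕ} (hk : k ≤ 3) :
    coreSum a i k ≤ X := by
  rw [← h.left_sum i]
  refine Finset.sum_le_sum_of_subset_of_nonneg (Finset.range_mono (by omega)) fun l hl _ => ?_
  exact h.unit_nonneg.trans (h.left_ge i l (by simp at hl; omega))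

theorem potential_core_gap_far (h : Separated e X m G a b) (i j : ℕ) {k t : ℕ} (hk : k ≤ 3)
    (ht : 15 ≤ t) : G i j + coreSum a i k ≤ potential e X m G a b (core i k) (gap j t) := by
  refine le_min le_rfl ?_
  have h12 : (12 : ℝ) ≤ ((t - k : ℕ) : ℝ) := by exact_mod_cast (by omega : 12 ≤ t - k)
  nlinarith [h.le_succ_left i j, h.X_le, h.unit_nonneg]

theorem potential_core_gap_last (h : Separated e X m G a b) (i j t : ℕ) :
    G (i + 1) j ≤ potential e X m G a b (core i 3) (gap j t) := by
  refine le_min ?_ ?_ <;> rw [h.left_sum]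
  · exact h.succ_left_le i j
  · nlinarith [h.unit_nonneg, Nat.cast_nonneg (α := ℝ) (t - 3)]

theorem potential_core_core_le (e X : ℝ) (m G a b : ℕ → ℕ → ℝ) (i j k l : ℕ) :
    potential e X m G a b (core i k) (core j l) ≤ G i j + m i j := by
  rw [potential]
  split_ifs
  · linarith [min_le_left (m i j) (alignSum a b i j k)]
  · exact le_rfl

theorem potential_core_core_ge (h : Separated e X m G a b) (i j k l : ℕ) :
    G i j ≤ potential e X m G a b (core i k) (core j l) := by
  rw [potential]
  split_ifs
  · linarith [le_min (h.m_nonneg i j) (alignSum_nonneg (a := a) (b := b) i j k)]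
  · linarith [h.m_nonneg i j]

theorem potential_core_core_of_ne (e X : ℝ) (m G a b : ℕ → ℕ → ℝ) (i j : ℕ) {k l : ℕ}
    (hkl : k ≠ l) :
    potential e X m G a b (core i k) (core j l) = G i j + m i j := by
  simp [potential, hkl]

theorem potential_core_core_last (h : Separated e X m G a b) (i j k : ℕ) :
    potential e X m G a b (core i k) (core j 3) = G i j + m i j := by
  by_cases hk : k = 3
  · subst hk
    simp [potential, h.m_le_align i j]
  · exact potential_core_core_of_ne e X m G a b i j hk

/-- Entering an off-diagonal core-core pair of positions. -/
theorem potential_cross_le (h : Separated e X m G a b) (i j : ℕ) {k l : ℕ} (hk : k ≤ 3)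
    (hl : l ≤ 3) (hkl : k ≠ l) :
    potential e X m G a b (core i k) (core j l) ≤ G i j + |a i k - b j l| := by
  linarith [potential_core_core_of_ne e X m G a b i j hkl,
    h.m_le_cross i j k l hk hl hkl]

theorem potential_next_left (h : Separated e X m G a b) {x x' y : CurvePos} (hx : Next x x')
    (hy : y.Valid) :
    potential e X m G a b x' y ≤ potential e X m G a b x y + |height a x' - height b y| := by
  have abs0 {z : ℝ} (hz : e ≤ z) : |z - 0| = z := by
    rw [sub_zero, abs_of_nonneg (h.unit_nonneg.trans hz)]
  have abs1 {z : ℝ} (hz : e ≤ z) : |0 - z| = z := by rw [abs_sub_comm, abs0 hz]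
  cases hx with
  | gap_gap i s =>
    cases y with
    | gap j t => simp [potential, height]
    | core j l =>
      simp only [height]
      rw [abs1 (h.right_ge j l hy)]
      have hc : ((s + 1 - l : ℕ) : ℝ) ≤ ((s - l : ℕ) : ℝ) + 1 := by
        exact_mod_cast (by omega : s + 1 - l ≤ s - l + 1)
      have := h.right_ge j l hy
      have := h.unit_nonneg
      simp only [potential]
      rw [← min_add_add_right]
      exact min_le_min (by linarith) (by nlinarith)
  | gap_core i s hs =>
    cases y with
    | gap j t =>
      simp only [height]
      rw [abs0 (h.left_ge i 0 (by omega))]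
      simp only [potential, coreSum_zero]
      exact min_le_left _ _
    | core j l =>
      have hfar := h.swap.potential_core_gap_far j i hy hs
      rw [potential_swap] at hfar
      have := h.swap.unit_le_coreSum j hy
      have := potential_core_core_le e X m G a b i j 0 l
      have := h.m_le_unit i j
      linarith [abs_nonneg (height a (core i 0) - height b (core j l))]
  | core_core i k hk =>
    cases y with
    | gap j t =>
      simp only [height]
      have ha := h.left_ge i (k + 1) (by omega)
      rw [abs0 ha]
      have hc : ((t - (k + 1) : ℕ) : ℝ) ≤ ((t - k : ℕ) : ℝ) := by
        exact_mod_cast (by omega : t - (k + 1) ≤ t - k)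
      have := h.unit_nonneg
      simp only [potential, coreSum_succ]
      rw [← min_add_add_right]
      exact min_le_min (by linarith) (by nlinarith)
    | core j l =>
      have hge := h.potential_core_core_ge i j k l
      by_cases hkl : k + 1 = l
      · have := potential_core_core_of_ne e X m G a b i j
          (by omega : k ≠ l)
        linarith [potential_core_core_le e X m G a b i j (k + 1) l,
          abs_nonneg (height a (core i (k + 1)) - height b (core j l))]
      · have := h.potential_cross_le i j (by omega : k + 1 ≤ 3) hy hkl
        simp only [height]
        linarith
  | core_gap i =>
    cases y with
    | gap j t =>
      have := h.potential_core_gap_last i j t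
      simpa [potential, height] using this
    | core j l =>
      have hb := h.right_ge j l hy
      have hlast := h.swap.potential_core_core_last j i l
      rw [potential_swap] at hlast
      simp only [height]
      rw [hlast, abs1 hb]
      have hl := h.swap.coreSum_le j hy
      refine (min_le_right _ _).trans ?_
      simp only [Nat.zero_sub, Nat.cast_zero, zero_mul, add_zero]
      have hl' : coreSum b j l ≤ X - 0 := by linarith
      have : coreSum b j l - b j l ≤ X := by linarith [h.unit_nonneg]
      linarith [h.succ_succ_le i j]

theorem potential_next_right (h : Separated e X m G a b) {x y y' : CurvePos} (hx : x.Valid)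
    (hy : Next y y') :
    potential e X m G a b x y' ≤ potential e X m G a b x y + |height a x - height b y'| := by
  have := h.swap.potential_next_left hy hx
  rw [potential_swap x y', potential_swap x y, abs_sub_comm] at this
  exact this

theorem potential_next_both (h : Separated e X m G a b) {x x' y y' : CurvePos} (hx : Next x x')
    (hy : Next y y') :
    potential e X m G a b x' y' ≤ potential e X m G a b x y + |height a x' - height b y'| := by
  have abs0 {z : ℝ} (hz : e ≤ z) : |z - 0| = z := by
    rw [sub_zero, abs_of_nonneg (h.unit_nonneg.trans hz)]
  have abs1 {z : ℝ} (hz : e ≤ z) : |0 - z| = z := by rw [abs_sub_comm, abs0 hz]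
  cases hx with
  | gap_gap i s =>
    cases hy with
    | gap_gap j t => simp [potential, height]
    | gap_core j t ht =>
      simp only [height]
      rw [abs1 (h.right_ge j 0 (by omega))]
      simp only [potential, coreSum_zero]
      exact min_le_left _ _
    | core_core j l hl =>
      simp only [height]
      rw [abs1 (h.right_ge j (l + 1) (by omega))]
      simp only [potential, coreSum_succ, Nat.add_sub_add_right]
      rw [← min_add_add_right]
      exact min_le_min (by linarith) (by linarith)
    | core_gap j =>
      have := h.swap.potential_core_gap_last j i s
      rw [potential_swap] at this
      simpa [potential, height] using this
  | gap_core i s hs =>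
    cases hy with
    | gap_gap j t =>
      simp only [height]
      rw [abs0 (h.left_ge i 0 (by omega))]
      simp only [potential, coreSum_zero]
      exact min_le_left _ _
    | gap_core j t ht =>
      simp only [potential, height, alignSum_zero, if_true]
      linarith [min_le_right (m i j) |a i 0 - b j 0|]
    | core_core j l hl =>
      have hfar := h.swap.potential_core_gap_far j i (by omega : l ≤ 3) hs
      rw [potential_swap] at hfar
      have := h.swap.unit_le_coreSum j (by omega : l ≤ 3)
      have := potential_core_core_le e X m G a b i j 0 (l + 1)
      have := h.m_le_unit i j
      linarith [abs_nonneg (height a (core i 0) - height b (core j (l + 1)))]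
    | core_gap j =>
      have := h.swap.potential_core_gap_last j i s
      rw [potential_swap] at this
      simp only [height]
      rw [abs0 (h.left_ge i 0 (by omega))]
      refine (min_le_left _ _).trans ?_
      rw [coreSum_zero]
      linarith
  | core_core i k hk =>
    cases hy with
    | gap_gap j t =>
      simp only [height]
      rw [abs0 (h.left_ge i (k + 1) (by omega))]
      simp only [potential, coreSum_succ, Nat.add_sub_add_right]
      rw [← min_add_add_right]
      exact min_le_min (by linarith) (by linarith)
    | gap_core j t ht =>
      have hfar := h.potential_core_gap_far i j (by omega : k ≤ 3) ht
      have := h.unit_le_coreSum i (by omega : k ≤ 3)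
      have := potential_core_core_le e X m G a b i j (k + 1) 0
      have := h.m_le_unit i j
      linarith [abs_nonneg (height a (core i (k + 1)) - height b (core j 0))]
    | core_core j l hl =>
      have hw := abs_nonneg (a i (k + 1) - b j (l + 1))
      simp only [potential, height, add_left_inj]
      split_ifs with hkl
      · subst hkl
        rw [alignSum_succ, add_assoc, ← min_add_add_right]
        exact add_le_add_right (min_le_min (by linarith) le_rfl) _
      · linarith
    | core_gap j =>
      have hlast := h.potential_core_core_last i j k
      have ha := h.left_ge i (k + 1) (by omega)
      have hk' := h.coreSum_le i (by omega : k ≤ 3)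
      simp only [height]
      rw [hlast, abs0 ha]
      refine (min_le_right _ _).trans ?_
      rw [coreSum_succ]
      simp only [Nat.zero_sub, Nat.cast_zero, zero_mul, add_zero]
      linarith [h.succ_succ_le i j]
  | core_gap i =>
    cases hy with
    | gap_gap j t =>
      have := h.potential_core_gap_last i j t
      simpa [potential, height] using this
    | gap_core j t ht =>
      have := h.potential_core_gap_last i j t
      simp only [height]
      rw [abs1 (h.right_ge j 0 (by omega))]
      refine (min_le_left _ _).trans ?_
      rw [coreSum_zero]
      linarith
    | core_core j l hl =>
      have hlast := h.swap.potential_core_core_last j i l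
      rw [potential_swap] at hlast
      have hb := h.right_ge j (l + 1) (by omega)
      have hl' := h.swap.coreSum_le j (by omega : l ≤ 3)
      simp only [height]
      rw [hlast, abs1 hb]
      refine (min_le_right _ _).trans ?_
      rw [coreSum_succ]
      simp only [Nat.zero_sub, Nat.cast_zero, zero_mul, add_zero]
      linarith [h.succ_succ_le i j]
    | core_gap j =>
      rw [h.potential_core_core_last]
      simpa [potential, height] using h.succ_succ_le i j

end Separated

end Potential

/-- The position at index `p`, counted from `0`, of a concatenation of 20-point curves, each
consisting of a core with eight stars on either side. -/
def ofIndex : ℕ → CurvePos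
  | 0 => gap 0 8
  | p + 1 =>
    match ofIndex p with
    | gap i s => if s < 15 then gap i (s + 1) else core i 0
    | core i k => if k < 3 then core i (k + 1) else gap (i + 1) 0

theorem valid_ofIndex (p : ℕ) : (ofIndex p).Valid := by
  induction p with
  | zero => trivial
  | succ p _ =>
    rw [ofIndex]
    split <;> split_ifs <;> first | trivial | (simp only [Valid]; omega)

theorem next_ofIndex (p : ℕ) : Next (ofIndex p) (ofIndex (p + 1)) := by
  have hv := valid_ofIndex p
  rw [ofIndex]
  split <;> rename_i i k h <;> rw [h] at hv ⊢ <;> split_ifs with hk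
  · exact .gap_gap i k
  · exact .gap_core i k (by omega)
  · exact .core_core i k hk
  · obtain rfl : k = 3 := by simp only [Valid] at hv; omega
    exact .core_gap i

theorem ofIndex_mul (i : ℕ) : ofIndex (20 * i) = gap i 8 := by
  induction i with
  | zero => rfl
  | succ i ih => simp [Nat.mul_add, ofIndex, ih]

theorem ofIndex_mul_add (i o : ℕ) (ho : o < 20) : ofIndex (20 * i + o) =
    if o < 8 then gap i (8 + o) else if o < 12 then core i (o - 8) else gap (i + 1) (o - 12) := by
  have h := ofIndex_mul i
  interval_cases o <;> simp [ofIndex, h]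

end CurvePos

open CurvePos

/-- The curve, indexed from `1`, whose 20-point block number `i` is `v i 0, …, v i 19`. -/
def blockCurve (v : ℕ → ℕ → ℝ) (k : ℕ) : ℝ := v ((k - 1) / 20) ((k - 1) % 20)

/-- All entries of the blocks `v i` are `z` outside the four core offsets. -/
def StarPadded (z : ℝ) (v : ℕ → ℕ → ℝ) : Prop := ∀ i o, o < 8 ∨ 12 ≤ o → v i o = z

/-- Heights above `z` of the core entries of the blocks `v i`. -/
def coreHeight (z : ℝ) (v : ℕ → ℕ → ℝ) (i k : ℕ) : ℝ := v i (8 + k) - z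

/-- The arc weights for which walks from a vertex of weight `0` measure warping costs. -/
def warpWeight (v w : ℕ → ℕ → ℝ) (_ u : ℕ × ℕ) : ℝ := |blockCurve v u.1 - blockCurve w u.2|

section Blocks

variable {z : ℝ} {v w : ℕ → ℕ → ℝ}

theorem blockCurve_mul_add (v : ℕ → ℕ → ℝ) (i : ℕ) {o : ℕ} (ho : o < 20) :
    blockCurve v (20 * i + o + 1) = v i o := by
  have h1 : (20 * i + o + 1 - 1) / 20 = i := by omega
  have h2 : (20 * i + o + 1 - 1) % 20 = o := by omega
  rw [blockCurve, h1, h2]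

theorem blockCurve_succ (hv : StarPadded z v) (p : ℕ) :
    blockCurve v (p + 1) = z + height (coreHeight z v) (ofIndex p) := by
  obtain ⟨i, o, ho, rfl⟩ : ∃ i o, o < 20 ∧ p = 20 * i + o :=
    ⟨p / 20, p % 20, Nat.mod_lt _ (by norm_num), (Nat.div_add_mod p 20).symm⟩
  rw [blockCurve_mul_add v i ho, ofIndex_mul_add i o ho]
  split_ifs with h1 h2
  · simp [height, hv i o (.inl h1)]
  · simp [height, coreHeight, show 8 + (o - 8) = o by omega]
  · simp [height, hv i o (.inr (by omega))]

theorem warpWeight_succ (hv : StarPadded z v) (hw : StarPadded z w) (u : ℕ × ℕ) (p q : ℕ) :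
    warpWeight v w u (p + 1, q + 1) =
      |height (coreHeight z v) (ofIndex p) - height (coreHeight z w) (ofIndex q)| := by
  simp [warpWeight, blockCurve_succ hv, blockCurve_succ hw]

theorem gridDist_le_of_gridWalk_warpWeight {e X C : ℝ} {m : ℕ → ℕ → ℝ} {n n' : ℕ} (hn : 1 ≤ n)
    (hn' : 1 ≤ n') (hv : StarPadded z v) (hw : StarPadded z w)
    (h : Separated e X m (gridDist X m) (coreHeight z v) (coreHeight z w))
    (hC : GridWalk (warpWeight v w) (1, 1) (20 * n, 20 * n') C) : gridDist X m n n' ≤ C := by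
  have hend : ∀ n, 1 ≤ n → ofIndex (20 * n - 1) = gap n 7 := fun n hn => by
    obtain ⟨k, rfl⟩ : ∃ k, n = k + 1 := ⟨n - 1, by omega⟩
    rw [show 20 * (k + 1) - 1 = 20 * k + 19 by omega, ofIndex_mul_add _ _ (by norm_num)]
    simp
  have key := hC.potential_le (f := fun u => potential e X m (gridDist X m) (coreHeight z v)
    (coreHeight z w) (ofIndex (u.1 - 1)) (ofIndex (u.2 - 1))) ?_
  · simpa [hend n hn, hend n' hn', ofIndex, potential, gridDist] using key
  · rintro ⟨p, q⟩ ⟨p', q'⟩ hp hq hs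
    obtain ⟨p, rfl⟩ : ∃ k, p = k + 1 := ⟨p - 1, by simp at hp; omega⟩
    obtain ⟨q, rfl⟩ : ∃ k, q = k + 1 := ⟨q - 1, by simp at hq; omega⟩
    simp only [MStep] at hs
    obtain ⟨rfl, rfl⟩ | ⟨rfl, rfl⟩ | ⟨rfl, rfl⟩ := hs <;> rw [warpWeight_succ hv hw]
    · exact h.potential_next_left (next_ofIndex p) (valid_ofIndex q)
    · exact h.potential_next_right (valid_ofIndex p) (next_ofIndex q)
    · exact h.potential_next_both (next_ofIndex p) (next_ofIndex q)

/-- The curve index, counted from `1`, at which block `i` has been preceded by `i` full blocks. -/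
def blockStart (i : ℕ) : ℕ := 20 * i - 1 + 1

theorem blockStart_succ (i : ℕ) : blockStart (i + 1) = 20 * i + 1 + 19 := by
  simp only [blockStart]; omega

theorem blockStart_cases (i : ℕ) : blockStart i = 20 * i + 1 ∨ blockStart i + 1 = 20 * i + 1 := by
  simp only [blockStart]; omega

theorem blockCurve_blockStart (hv : StarPadded z v) (i : ℕ) : blockCurve v (blockStart i) = z := by
  cases i with
  | zero => exact hv _ _ (by simp [blockStart])
  | succ i =>
    rw [blockStart_succ, add_right_comm, blockCurve_mul_add v i (by norm_num)]
    exact hv _ _ (by simp)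

theorem blockCurve_mul_add_one (hv : StarPadded z v) (i : ℕ) :
    blockCurve v (20 * i + 1) = z := by
  rw [← hv i 0 (by simp), ← blockCurve_mul_add v i (by norm_num), add_zero]

theorem sum_blocks (hv : StarPadded z v) (hw : StarPadded z w) (i j : ℕ) :
    ∑ k ∈ Finset.range 19, |v i (k + 1) - w j (k + 1)| =
      ∑ k ∈ Finset.range 4, |coreHeight z v i k - coreHeight z w j k| := by
  simp [Finset.sum_range_succ, coreHeight, hv i _ (.inl _), hv i _ (.inr _), hw j _ (.inl _),
    hw j _ (.inr _)]

theorem sum_block (hv : StarPadded z v) (i : ℕ) :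
    ∑ k ∈ Finset.range 19, |v i (k + 1) - z| = ∑ k ∈ Finset.range 4, |coreHeight z v i k| := by
  simp [Finset.sum_range_succ, coreHeight, hv i _ (.inl _), hv i _ (.inr _)]

theorem gridWalk_warpWeight_of_gridWeight {X C : ℝ} (hv : StarPadded z v) (hw : StarPadded z w)
    (hvX : ∀ i, ∑ k ∈ Finset.range 4, |coreHeight z v i k| = X)
    (hwX : ∀ j, ∑ k ∈ Finset.range 4, |coreHeight z w j k| = X) {s t : ℕ × ℕ}
    (h : GridWalk (gridWeight X fun i j => alignSum (coreHeight z v) (coreHeight z w) i j 3) s t C) :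
    GridWalk (warpWeight v w) (blockStart s.1, blockStart s.2) (blockStart t.1, blockStart t.2) C := by
  have left (i q : ℕ) (hq : blockCurve w q = z) :
      GridWalk (warpWeight v w) (blockStart i, q) (20 * i + 1, q) 0 := by
    rcases blockStart_cases i with hi | hi
    · rw [hi]; exact .refl _
    · have h0 : warpWeight v w (blockStart i, q) (20 * i + 1, q) = 0 := by
        simp [warpWeight, blockCurve_mul_add_one hv, hq]
      exact h0 ▸ GridWalk.single (by simp [MStep, hi])
  have right (p j : ℕ) (hp : blockCurve v p = z) :
      GridWalk (warpWeight v w) (p, blockStart j) (p, 20 * j + 1) 0 := by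
    rcases blockStart_cases j with hj | hj
    · rw [hj]; exact .refl _
    · have h0 : warpWeight v w (p, blockStart j) (p, 20 * j + 1) = 0 := by
        simp [warpWeight, blockCurve_mul_add_one hw, hp]
      exact h0 ▸ GridWalk.single (by simp [MStep, hj])
  have shift (f : ℕ → ℕ → ℝ) (i k : ℕ) (hk : k ∈ Finset.range 19) :
      blockCurve f (20 * i + 1 + k + 1) = f i (k + 1) := by
    rw [Finset.mem_range] at hk
    rw [add_assoc (20 * i) 1 k, add_comm 1 k, blockCurve_mul_add f i (by omega)]
  induction h with
  | refl => exact .refl _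
  | @head s u t C hs _ ih =>
    refine GridWalk.trans ?_ ih
    obtain ⟨i, j⟩ := s
    obtain ⟨i', j'⟩ := u
    simp only [MStep] at hs
    obtain ⟨rfl, rfl⟩ | ⟨rfl, rfl⟩ | ⟨rfl, rfl⟩ := hs
    · have hq := blockCurve_blockStart hw j'
      convert (left i _ hq).trans (.vert _ _ _ 19) using 1
      · rw [blockStart_succ]
      · simp only [gridWeight, Prod.mk.injEq, Nat.left_eq_add, one_ne_zero, and_false, if_false,
          zero_add, warpWeight, hq]
        rw [← hvX i, ← sum_block hv i]
        exact Finset.sum_congr rfl fun k hk => by rw [shift v i k hk]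
    · have hp := blockCurve_blockStart hv i'
      convert (right _ j hp).trans (.horiz _ _ _ 19) using 1
      · rw [blockStart_succ]
      · simp only [gridWeight, Prod.mk.injEq, Nat.left_eq_add, one_ne_zero, false_and, if_false,
          zero_add, warpWeight, hp]
        rw [← hwX j, ← sum_block hw j]
        exact Finset.sum_congr rfl fun k hk => by rw [shift w j k hk, abs_sub_comm]
    · have hd : GridWalk (warpWeight v w) (blockStart i, blockStart j) (20 * i + 1, 20 * j + 1) 0 := by
        simpa using (left i _ (blockCurve_blockStart hw j)).trans
          (right _ j (blockCurve_mul_add_one hv i))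
      convert hd.trans (.diag _ _ _ 19) using 1
      · rw [blockStart_succ, blockStart_succ]
      · simp only [gridWeight, if_true, zero_add, warpWeight, alignSum]
        rw [← sum_blocks hv hw]
        exact Finset.sum_congr rfl fun k hk => by rw [shift v i k hk, shift w j k hk]

end Blocks

/-- Diagonal arc weights `δ + d i * b j` where `r i = c j`, and `big i j` elsewhere. -/
noncomputable def diagWeight (r c d b : ℕ → ℕ) (δ : ℝ) (big : ℕ → ℕ → ℝ) (i j : ℕ) : ℝ :=
  if r i = c j then δ + ((d i * b j : ℕ) : ℝ) else big i j

theorem interW_eq_gridWeight (r c d b : ℕ → ℕ) (U : ℕ) :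
    interW r c d b U = gridWeight U (diagWeight r c d b 0 fun _ _ => Real.sqrt U) := by
  funext u v
  simp [interW, gridWeight, diagWeight]

/-- A walk either uses a mismatched diagonal arc, or has the same matched diagonal arcs as a walk
for any other choice of the remaining weights. -/
theorem GridWalk.matched_or_large {r c d b : ℕ → ℕ} {M : ℕ} (hd : ∀ i, d i ≤ M)
    (hb : ∀ j, b j ≤ 1) {X δ B : ℝ} {big : ℕ → ℕ → ℝ} (hδ : 0 ≤ δ) (hB : 0 ≤ B)
    (hbig : ∀ i j, B ≤ big i j) (X' δ' : ℝ) (big' : ℕ → ℕ → ℝ) {s t : ℕ × ℕ} {C : ℝ}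
    (h : GridWalk (gridWeight X (diagWeight r c d b δ big)) s t C) :
    ∃ x y k : ℕ, t.1 = s.1 + x + k ∧ t.2 = s.2 + y + k ∧
      ((∃ E : ℝ, 0 ≤ E ∧ E ≤ k * M ∧ C = (x + y) * X + k * δ + E ∧
          GridWalk (gridWeight X' (diagWeight r c d b δ' big')) s t ((x + y) * X' + k * δ' + E)) ∨
        (x + y) * X + B ≤ C) := by
  induction h with
  | refl s => exact ⟨0, 0, 0, by simp, by simp, .inl ⟨0, by simp, by simp, by simp, by
      simpa using GridWalk.refl s⟩⟩
  | @head s u t C hs _ ih =>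
    obtain ⟨x, y, k, hx, hy, ih⟩ := ih
    have hs' := hs
    obtain ⟨i, j⟩ := s
    obtain ⟨i', j'⟩ := u
    simp only [MStep] at hs'
    obtain ⟨rfl, rfl⟩ | ⟨rfl, rfl⟩ | ⟨rfl, rfl⟩ := hs'
    · refine ⟨x + 1, y, k, by simp only at hx ⊢; omega, hy, ?_⟩
      have hw : ∀ X m, gridWeight X m (i, j') (i + 1, j') = X := fun X m => by simp [gridWeight]
      rw [hw]
      push_cast
      refine ih.imp ?_ fun h => by linarith
      rintro ⟨E, hE, hEk, rfl, hG⟩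
      refine ⟨E, hE, hEk, by ring, ?_⟩
      convert head hs hG using 1
      rw [hw]; ring
    · refine ⟨x, y + 1, k, hx, by simp only at hy ⊢; omega, ?_⟩
      have hw : ∀ X m, gridWeight X m (i', j) (i', j + 1) = X := fun X m => by simp [gridWeight]
      rw [hw]
      push_cast
      refine ih.imp ?_ fun h => by linarith
      rintro ⟨E, hE, hEk, rfl, hG⟩
      refine ⟨E, hE, hEk, by ring, ?_⟩
      convert head hs hG using 1
      rw [hw]; ring
    · refine ⟨x, y, k + 1, by simp only at hx ⊢; omega, by simp only at hy ⊢; omega, ?_⟩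
      have hw : ∀ X m, gridWeight X m (i, j) (i + 1, j + 1) = m i j := fun X m => by
        simp [gridWeight]
      rw [hw]
      push_cast
      have hk : (0 : ℝ) ≤ k := k.cast_nonneg
      by_cases hrc : r i = c j
      · have hD : (0 : ℝ) ≤ ((d i * b j : ℕ) : ℝ) := Nat.cast_nonneg _
        have hD' : ((d i * b j : ℕ) : ℝ) ≤ M := by
          exact_mod_cast (Nat.mul_le_mul (hd i) (hb j)).trans_eq (mul_one M)
        have hm : ∀ δ big, diagWeight r c d b δ big i j = δ + ((d i * b j : ℕ) : ℝ) := fun δ big => by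
          simp [diagWeight, hrc]
        rw [hm]
        refine ih.imp ?_ fun h => by linarith
        rintro ⟨E, hE, hEk, rfl, hG⟩
        refine ⟨E + ((d i * b j : ℕ) : ℝ), by linarith, by linarith, by ring, ?_⟩
        convert head hs hG using 1
        rw [hw, hm]; ring
      · right
        have hm : diagWeight r c d b δ big i j = big i j := by simp [diagWeight, hrc]
        rw [hm]
        have := hbig i j
        rcases ih with ⟨E, hE, -, rfl, -⟩ | h
        · nlinarith [mul_nonneg hk hδ]
        · linarith

theorem sInf_lt_iff_and_eq {S T : Set ℝ} {x y ε q : ℝ} (hS : S.Nonempty) (hT : T.Nonempty)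
    (hS0 : ∀ C ∈ S, 0 ≤ C) (hT0 : ∀ C ∈ T, 0 ≤ C) (hq : y + ε ≤ q)
    (hST : ∀ C ∈ S, C < x + ε → ∃ E < ε, C = x + E ∧ y + E ∈ T)
    (hTS : ∀ C ∈ T, C < q → ∃ E < ε, y + E ≤ C ∧ x + E ∈ S) :
    (sInf S < x + ε ↔ sInf T < q) ∧ (sInf S < x + ε → sInf T = sInf S - x + y) := by
  have hSb : BddBelow S := ⟨0, hS0⟩
  have hTb : BddBelow T := ⟨0, hT0⟩
  have fwd : sInf S < x + ε → sInf T < y + ε := fun h => by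
    obtain ⟨C, hC, hlt⟩ := exists_lt_of_csInf_lt hS h
    obtain ⟨E, hE, -, hET⟩ := hST C hC hlt
    linarith [csInf_le hTb hET]
  refine ⟨⟨fun h => (fwd h).trans_le hq, fun h => ?_⟩, fun h => le_antisymm ?_ ?_⟩
  · obtain ⟨C, hC, hlt⟩ := exists_lt_of_csInf_lt hT h
    obtain ⟨E, hE, -, hES⟩ := hTS C hC hlt
    linarith [csInf_le hSb hES]
  · suffices sInf T + x - y ≤ sInf S by linarith
    refine le_csInf hS fun C hC => ?_
    by_cases hlt : C < x + ε
    · obtain ⟨E, -, rfl, hET⟩ := hST C hC hlt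
      linarith [csInf_le hTb hET]
    · linarith [fwd h]
  · refine le_csInf hT fun C hC => ?_
    by_cases hlt : C < q
    · obtain ⟨E, -, hEC, hES⟩ := hTS C hC hlt
      linarith [csInf_le hSb hES]
    · linarith

theorem abs_sub_eq_or_lt {n n' x y k : ℕ} (hx : n = x + k) (hy : n' = y + k) :
    (|(n : ℝ) - n'| = x + y ∧ min n n' = k) ∨ |(n : ℝ) - n'| + 1 ≤ x + y := by
  subst hx hy
  push_cast
  rw [add_sub_add_right_eq_sub]
  rcases Nat.eq_zero_or_pos x with rfl | hx
  · left; simp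
  rcases Nat.eq_zero_or_pos y with rfl | hy
  · left; simp
  right
  have hx' : (1 : ℝ) ≤ x := by exact_mod_cast hx
  have hy' : (1 : ℝ) ≤ y := by exact_mod_cast hy
  rcases abs_cases ((x : ℝ) - y) with ⟨h, -⟩ | ⟨h, -⟩ <;> rw [h] <;> linarith

theorem starPadded_alphaVal (U : ℕ) (r d : ℕ → ℕ) : StarPadded (starPt U) (alphaVal U r d) := by
  intro i o ho
  simp only [alphaVal]
  split_ifs <;> first | omega | rfl

theorem starPadded_betaVal (U : ℕ) (c b : ℕ → ℕ) : StarPadded (starPt U) (betaVal U c b) := by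
  intro i o ho
  simp only [betaVal]
  split_ifs <;> first | omega | rfl

section CoreBounds

variable {U : ℕ} {r c d b : ℕ → ℕ}

theorem neg_one_pow_cases {n : ℕ} (hn : n ≤ 1) :
    (n = 0 ∧ (-1 : ℝ) ^ n = 1) ∨ (n = 1 ∧ (-1 : ℝ) ^ n = -1) := by
  interval_cases n <;> simp

/-- Comparison of the powers of `U` that occur in the construction. -/
theorem pow_bounds (hU : 100 ≤ U) :
    100 * (U : ℝ) ≤ (U : ℝ) ^ 3 ∧ 100 * (U : ℝ) ^ 3 ≤ (U : ℝ) ^ 4 ∧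
      100 * (U : ℝ) ^ 4 ≤ (U : ℝ) ^ 5 := by
  have hU' : (100 : ℝ) ≤ U := by exact_mod_cast hU
  have h1 : (100 : ℝ) ≤ (U : ℝ) ^ 2 := by nlinarith
  have h3 : (0 : ℝ) ≤ (U : ℝ) ^ 3 := by positivity
  have h4 : (0 : ℝ) ≤ (U : ℝ) ^ 4 := by positivity
  refine ⟨?_, ?_, ?_⟩
  · calc 100 * (U : ℝ) ≤ (U : ℝ) ^ 2 * U := by gcongr
      _ = (U : ℝ) ^ 3 := by ring
  · calc 100 * (U : ℝ) ^ 3 ≤ U * (U : ℝ) ^ 3 := by gcongr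
      _ = (U : ℝ) ^ 4 := by ring
  · calc 100 * (U : ℝ) ^ 4 ≤ U * (U : ℝ) ^ 4 := by gcongr
      _ = (U : ℝ) ^ 5 := by ring

theorem mul_cube_bounds {n : ℕ} (hn : 100 * (n + 1) ≤ U) :
    0 ≤ (n : ℝ) * (U : ℝ) ^ 3 ∧ 100 * ((n : ℝ) * (U : ℝ) ^ 3) ≤ (U : ℝ) ^ 4 := by
  refine ⟨by positivity, ?_⟩
  have hn' : 100 * (n : ℝ) ≤ U := by exact_mod_cast (by omega : 100 * n ≤ U)
  calc 100 * ((n : ℝ) * (U : ℝ) ^ 3) = (100 * n) * (U : ℝ) ^ 3 := by ring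
    _ ≤ U * (U : ℝ) ^ 3 := by gcongr
    _ = (U : ℝ) ^ 4 := by ring

theorem le_coreHeight_alphaVal (hr : ∀ i, 100 * (r i + 1) ≤ U) (hd : ∀ i, 100 * (d i + 1) ≤ U)
    (i k : ℕ) (hk : k ≤ 3) : (U : ℝ) ^ 5 ≤ coreHeight (starPt U) (alphaVal U r d) i k := by
  obtain ⟨h1, h2, h3⟩ := pow_bounds (U := U) (by have := hr 0; omega)
  obtain ⟨h4, h5⟩ := mul_cube_bounds (hr i)
  have hd0 : (0 : ℝ) ≤ d i := by positivity
  have hd1 : (d i : ℝ) ≤ U := by exact_mod_cast (by have := hd i; omega : d i ≤ U)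
  interval_cases k <;> simp [coreHeight, alphaVal, starPt] <;> linarith

theorem le_coreHeight_betaVal (hc : ∀ j, 100 * (c j + 1) ≤ U) (hb : ∀ j, b j ≤ 1)
    (j k : ℕ) (hk : k ≤ 3) : (U : ℝ) ^ 5 ≤ coreHeight (starPt U) (betaVal U c b) j k := by
  obtain ⟨h1, h2, h3⟩ := pow_bounds (U := U) (by have := hc 0; omega)
  obtain ⟨h4, h5⟩ := mul_cube_bounds (hc j)
  have hU : (0 : ℝ) ≤ U := by positivity
  rcases neg_one_pow_cases (hb j) with ⟨-, hs⟩ | ⟨-, hs⟩ <;>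
    interval_cases k <;> simp [coreHeight, betaVal, starPt, hs] <;> linarith

theorem coreSum_alphaVal (U : ℕ) (r d : ℕ → ℕ) (i : ℕ) :
    coreSum (coreHeight (starPt U) (alphaVal U r d)) i 3 = 4 * (U : ℝ) ^ 5 + 10 * (U : ℝ) ^ 4 := by
  simp [coreSum, Finset.sum_range_succ, coreHeight, alphaVal, starPt]
  ring

theorem coreSum_betaVal (U : ℕ) (c b : ℕ → ℕ) (j : ℕ) :
    coreSum (coreHeight (starPt U) (betaVal U c b)) j 3 = 4 * (U : ℝ) ^ 5 + 10 * (U : ℝ) ^ 4 := by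
  simp [coreSum, Finset.sum_range_succ, coreHeight, betaVal, starPt]
  ring

theorem cube_le_cross (hr : ∀ i, 100 * (r i + 1) ≤ U) (hd : ∀ i, 100 * (d i + 1) ≤ U)
    (hc : ∀ j, 100 * (c j + 1) ≤ U) (hb : ∀ j, b j ≤ 1) (i j k l : ℕ) (hk : k ≤ 3) (hl : l ≤ 3)
    (hkl : k ≠ l) : (U : ℝ) ^ 3 ≤ |coreHeight (starPt U) (alphaVal U r d) i k -
      coreHeight (starPt U) (betaVal U c b) j l| := by
  obtain ⟨h1, h2, h3⟩ := pow_bounds (U := U) (by have := hr 0; omega)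
  obtain ⟨h4, h5⟩ := mul_cube_bounds (hr i)
  obtain ⟨h6, h7⟩ := mul_cube_bounds (hc j)
  have hU : (0 : ℝ) ≤ U := by positivity
  have hd0 : (0 : ℝ) ≤ d i := by positivity
  have hd1 : (d i : ℝ) ≤ U := by exact_mod_cast (by have := hd i; omega : d i ≤ U)
  rw [le_abs]
  simp only [coreHeight, sub_sub_sub_cancel_right]
  rcases neg_one_pow_cases (hb j) with ⟨-, hs⟩ | ⟨-, hs⟩ <;> interval_cases k <;>
    interval_cases l <;> first
    | exact absurd rfl hkl
    | (simp only [alphaVal, betaVal, hs]; norm_num; first | (left; linarith) | (right; linarith))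

theorem alignSum_of_eq (hd : ∀ i, 100 * (d i + 1) ≤ U) (hb : ∀ j, b j ≤ 1) {i j : ℕ}
    (hrc : r i = c j) :
    alignSum (coreHeight (starPt U) (alphaVal U r d)) (coreHeight (starPt U) (betaVal U c b)) i j 3 =
      4 * (U : ℝ) + ((d i * b j : ℕ) : ℝ) := by
  have hU : (0 : ℝ) ≤ U := by positivity
  have hd0 : (0 : ℝ) ≤ d i := by positivity
  have hd1 : (d i : ℝ) ≤ U := by exact_mod_cast (by have := hd i; omega : d i ≤ U)
  simp only [alignSum, Finset.sum_range_succ, Finset.sum_range_zero, coreHeight, alphaVal, betaVal,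
    sub_sub_sub_cancel_right, hrc]
  norm_num
  rcases neg_one_pow_cases (hb j) with ⟨hj, hs⟩ | ⟨hj, hs⟩ <;> rw [hs, hj]
  · rw [abs_of_nonneg, abs_of_nonpos, abs_of_nonpos, abs_of_nonneg] <;> push_cast <;> linarith
  · rw [abs_of_nonneg, abs_of_nonpos, abs_of_nonneg, abs_of_nonpos] <;> push_cast <;> linarith

theorem cube_le_alignSum (hU : 100 ≤ U) (hd : ∀ i, 100 * (d i + 1) ≤ U) {i j : ℕ}
    (hrc : r i ≠ c j) : (U : ℝ) ^ 3 ≤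
    alignSum (coreHeight (starPt U) (alphaVal U r d)) (coreHeight (starPt U) (betaVal U c b)) i j 3 := by
  obtain ⟨h1, h2, h3⟩ := pow_bounds hU
  have hU : (0 : ℝ) ≤ U := by positivity
  have hd0 : (0 : ℝ) ≤ d i := by positivity
  have hd1 : (d i : ℝ) ≤ U := by exact_mod_cast (by have := hd i; omega : d i ≤ U)
  have h3 : (0 : ℝ) ≤ (U : ℝ) ^ 3 := by positivity
  calc (U : ℝ) ^ 3 ≤ |coreHeight (starPt U) (alphaVal U r d) i 0 -
        coreHeight (starPt U) (betaVal U c b) j 0| := by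
        rw [le_abs]
        simp only [coreHeight, sub_sub_sub_cancel_right, alphaVal, betaVal]
        norm_num
        rcases Nat.lt_or_gt_of_ne hrc with h | h
        · right
          have : (r i : ℝ) + 1 ≤ c j := by exact_mod_cast h
          nlinarith
        · left
          have : (c j : ℝ) + 1 ≤ r i := by exact_mod_cast h
          nlinarith
    _ ≤ _ := Finset.single_le_sum (f := fun l => |coreHeight (starPt U) (alphaVal U r d) i l -
        coreHeight (starPt U) (betaVal U c b) j l|) (fun _ _ => abs_nonneg _) (by simp)

theorem diagWeight_alignSum (hd : ∀ i, 100 * (d i + 1) ≤ U) (hb : ∀ j, b j ≤ 1) :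
    (diagWeight r c d b (4 * U) fun i j => alignSum (coreHeight (starPt U) (alphaVal U r d))
      (coreHeight (starPt U) (betaVal U c b)) i j 3) =
    fun i j => alignSum (coreHeight (starPt U) (alphaVal U r d))
      (coreHeight (starPt U) (betaVal U c b)) i j 3 := by
  funext i j
  rw [diagWeight]
  split_ifs with h
  · exact (alignSum_of_eq hd hb h).symm
  · rfl

theorem diagWeight_nonneg {δ : ℝ} {big : ℕ → ℕ → ℝ} (hδ : 0 ≤ δ) (hbig : ∀ i j, 0 ≤ big i j)
    (i j : ℕ) : 0 ≤ diagWeight r c d b δ big i j := by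
  rw [diagWeight]
  split_ifs
  · positivity
  · exact hbig i j

theorem diagWeight_le_cube (hU : 100 ≤ U) (hd : ∀ i, 100 * (d i + 1) ≤ U) (hb : ∀ j, b j ≤ 1)
    (i j : ℕ) : diagWeight r c d b (4 * U) (fun _ _ => (U : ℝ) ^ 3) i j ≤ (U : ℝ) ^ 3 := by
  obtain ⟨h1, -⟩ := pow_bounds hU
  have hd' : ((d i * b j : ℕ) : ℝ) ≤ U := by
    have : d i * b j ≤ d i * 1 := Nat.mul_le_mul le_rfl (hb j)
    exact_mod_cast (by have := hd i; omega : d i * b j ≤ U)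
  have hU : (0 : ℝ) ≤ U := by positivity
  rw [diagWeight]
  split_ifs
  · linarith
  · exact le_rfl

theorem separated_coreHeight (hr : ∀ i, 100 * (r i + 1) ≤ U) (hd : ∀ i, 100 * (d i + 1) ≤ U)
    (hc : ∀ j, 100 * (c j + 1) ≤ U) (hb : ∀ j, b j ≤ 1) :
    Separated ((U : ℝ) ^ 5) (4 * (U : ℝ) ^ 5 + 10 * (U : ℝ) ^ 4)
      (diagWeight r c d b (4 * U) fun _ _ => (U : ℝ) ^ 3)
      (gridDist (4 * (U : ℝ) ^ 5 + 10 * (U : ℝ) ^ 4)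
        (diagWeight r c d b (4 * U) fun _ _ => (U : ℝ) ^ 3))
      (coreHeight (starPt U) (alphaVal U r d)) (coreHeight (starPt U) (betaVal U c b)) := by
  have hU : 100 ≤ U := by have := hr 0; omega
  obtain ⟨-, h2, h3⟩ := pow_bounds hU
  have h0 : (0 : ℝ) ≤ (U : ℝ) ^ 3 := by positivity
  have hX : 0 ≤ 4 * (U : ℝ) ^ 5 + 10 * (U : ℝ) ^ 4 := by positivity
  have hm : ∀ i j, 0 ≤ diagWeight r c d b (4 * U) (fun _ _ => (U : ℝ) ^ 3) i j :=
    diagWeight_nonneg (by positivity) fun _ _ => h0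
  have hm' := diagWeight_le_cube (r := r) (c := c) hU hd hb
  exact
    { X_le := by linarith
      m_nonneg := hm
      m_le_unit := fun i j => (hm' i j).trans (by linarith)
      m_le_align := fun i j => by
        by_cases h : r i = c j
        · rw [alignSum_of_eq hd hb h, diagWeight, if_pos h]
        · exact (hm' i j).trans (cube_le_alignSum hU hd h)
      m_le_cross := fun i j k l hk hl hkl =>
        (hm' i j).trans (cube_le_cross hr hd hc hb i j k l hk hl hkl)
      left_ge := le_coreHeight_alphaVal hr hd
      right_ge := le_coreHeight_betaVal hc hb
      left_sum := coreSum_alphaVal U r d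
      right_sum := coreSum_betaVal U c b
      succ_left_le := gridDist_succ_left_le
      succ_right_le := gridDist_succ_right_le
      le_succ_left := gridDist_le_succ_left hX hm
      le_succ_right := gridDist_le_succ_right hX hm
      succ_succ_le := gridDist_succ_succ_le }

end CoreBounds

theorem sInf_interW_lt_iff_and_sInf_warp_eq {n n' U M : ℕ} {r c d b : ℕ → ℕ} (hn : 1 ≤ n) (hn' : 1 ≤ n')
    (hr : ∀ i, 100 * (r i + 1) ≤ U) (hd : ∀ i, 100 * (d i + 1) ≤ U)
    (hc : ∀ j, 100 * (c j + 1) ≤ U) (hb : ∀ j, b j ≤ 1) (hM : ∀ i, d i ≤ M)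
    (hnU : min n n' ≤ U) (hMU : (min n n' * M) ^ 2 < U) :
    (sInf {C | GridWalk (interW r c d b U) (0, 0) (n, n') C}
        < |(n : ℝ) - (n' : ℝ)| * (U : ℝ) + Real.sqrt U
      ↔ sInf {C | GridWalk (warpWeight (alphaVal U r d) (betaVal U c b)) (1, 1)
          (20 * n, 20 * n') C}
        < |(n : ℝ) - (n' : ℝ)| * (4 * (U : ℝ) ^ 5 + 10 * (U : ℝ) ^ 4) + (U : ℝ) ^ 3) ∧
    (sInf {C | GridWalk (interW r c d b U) (0, 0) (n, n') C}
        < |(n : ℝ) - (n' : ℝ)| * (U : ℝ) + Real.sqrt U →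
      sInf {C | GridWalk (warpWeight (alphaVal U r d) (betaVal U c b)) (1, 1) (20 * n, 20 * n') C}
        = sInf {C | GridWalk (interW r c d b U) (0, 0) (n, n') C}
          - |(n : ℝ) - (n' : ℝ)| * (U : ℝ)
          + (|(n : ℝ) - (n' : ℝ)| * (4 * (U : ℝ) ^ 5 + 10 * (U : ℝ) ^ 4)
          + 4 * ((min n n' : ℕ) : ℝ) * (U : ℝ))) := by
  have hU : 100 ≤ U := by have := hr 0; omega
  obtain ⟨h1, h2, h3⟩ := pow_bounds hU
  have hU' : (100 : ℝ) ≤ U := by exact_mod_cast hU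
  have hsep := separated_coreHeight hr hd hc hb
  have hα := starPadded_alphaVal U r d
  have hβ := starPadded_betaVal U c b
  have hnU' : ((min n n' : ℕ) : ℝ) ≤ U := by exact_mod_cast hnU
  have hsqrt0 : 0 ≤ Real.sqrt U := Real.sqrt_nonneg _
  have hsqrt : Real.sqrt U < U := by
    rw [Real.sqrt_lt' (by linarith)]; nlinarith
  have hMU' : ((min n n' : ℕ) : ℝ) * M < Real.sqrt U := by
    rw [Real.lt_sqrt (by positivity)]; exact_mod_cast hMU
  have hsmall : 4 * ((min n n' : ℕ) : ℝ) * (U : ℝ) + Real.sqrt U ≤ (U : ℝ) ^ 3 := by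
    have h100 : 100 * (U : ℝ) ^ 2 ≤ (U : ℝ) ^ 3 := by nlinarith [sq_nonneg (U : ℝ)]
    nlinarith [mul_le_mul_of_nonneg_right hnU' (by linarith : (0 : ℝ) ≤ U)]
  set X : ℝ := 4 * (U : ℝ) ^ 5 + 10 * (U : ℝ) ^ 4 with hXdef
  have hUX : (U : ℝ) ^ 3 ≤ X := by
    have : (0 : ℝ) ≤ (U : ℝ) ^ 3 := by positivity
    linarith
  have hX0 : 0 ≤ X := by positivity
  have embed {C : ℝ} (h : GridWalk (gridWeight X (diagWeight r c d b (4 * U) fun i j =>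
      alignSum (coreHeight (starPt U) (alphaVal U r d)) (coreHeight (starPt U) (betaVal U c b))
        i j 3)) (0, 0) (n, n') C) :
      GridWalk (warpWeight (alphaVal U r d) (betaVal U c b)) (1, 1) (20 * n, 20 * n') C := by
    rw [diagWeight_alignSum hd hb] at h
    have habs : ∀ {f : ℕ → ℕ → ℝ}, (∀ i k, k ≤ 3 → (U : ℝ) ^ 5 ≤ f i k) →
        (∀ i, coreSum f i 3 = X) → ∀ i, ∑ k ∈ Finset.range 4, |f i k| = X := fun hf hs i => by
      rw [← hs i]
      refine Finset.sum_congr rfl fun k hk => abs_of_nonneg ?_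
      exact le_trans (by positivity) (hf i k (by simp at hk; omega))
    have := gridWalk_warpWeight_of_gridWeight hα hβ (habs hsep.left_ge hsep.left_sum)
      (habs hsep.right_ge hsep.right_sum) h
    have hs : ∀ n, 1 ≤ n → blockStart n = 20 * n := fun n hn => by simp only [blockStart]; omega
    simpa only [hs n hn, hs n' hn', show blockStart 0 = 1 from rfl] using this
  refine sInf_lt_iff_and_eq ?_ ?_ ?_ ?_ ?_ ?_ ?_
  · rw [interW_eq_gridWeight]
    exact ⟨_, gridWalk_gridDist _ _ n n'⟩
  · exact ⟨_, embed (gridWalk_gridDist _ _ n n')⟩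
  · refine fun C hC => GridWalk.nonneg (fun u v => ?_) hC
    simp only [interW]
    split_ifs <;> positivity
  · exact fun C hC => GridWalk.nonneg (fun u v => abs_nonneg _) hC
  · linarith
  · intro C hC hlt
    rw [interW_eq_gridWeight] at hC
    obtain ⟨x, y, k, hx, hy, hE⟩ := GridWalk.matched_or_large hM hb le_rfl hsqrt0 (fun _ _ => le_rfl)
      X (4 * U) (fun i j => alignSum (coreHeight (starPt U) (alphaVal U r d))
        (coreHeight (starPt U) (betaVal U c b)) i j 3) hC
    simp only [zero_add] at hx hy
    rcases abs_sub_eq_or_lt hx hy with ⟨hD, hk⟩ | hD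
    · rw [hD] at hlt ⊢
      rcases hE with ⟨E, hE0, hEk, rfl, hG⟩ | hE
      · refine ⟨E, by rw [hk] at hMU'; linarith, by ring, ?_⟩
        rw [hk]
        refine cast (congrArg _ ?_) (embed hG)
        ring
      · linarith
    · exfalso
      have := mul_le_mul_of_nonneg_right hD (by linarith : (0 : ℝ) ≤ U)
      rcases hE with ⟨E, hE0, hEk, rfl, hG⟩ | hE <;> linarith
  · intro C hC hlt
    have hGC := gridDist_le_of_gridWalk_warpWeight hn hn' hα hβ hsep hC
    obtain ⟨x, y, k, hx, hy, hE⟩ := (gridWalk_gridDist X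
      (diagWeight r c d b (4 * U) fun _ _ => (U : ℝ) ^ 3) n n').matched_or_large hM hb
      (by positivity) (by positivity : (0 : ℝ) ≤ (U : ℝ) ^ 3) (fun _ _ => le_rfl) U 0
      fun _ _ => Real.sqrt U
    rw [← interW_eq_gridWeight] at hE
    simp only [zero_add] at hx hy
    rcases abs_sub_eq_or_lt hx hy with ⟨hD, hk⟩ | hD
    · rw [hD] at hlt ⊢
      rcases hE with ⟨E, hE0, hEk, hGE, hG⟩ | hE
      · refine ⟨E, by rw [hk] at hMU'; linarith, by rw [hk]; linarith, ?_⟩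
        simpa using hG
      · linarith
    · exfalso
      have := mul_le_mul_of_nonneg_right hD hX0
      have hkU : 0 ≤ (k : ℝ) * (4 * U) := by positivity
      have hU3 : 0 ≤ (U : ℝ) ^ 3 := by positivity
      rcases hE with ⟨E, hE0, hEk, hGE, hG⟩ | hE <;> linarith

/-- The values of `f` below `n`, continued by `0`. -/
def truncate (n : ℕ) (f : ℕ → ℕ) (i : ℕ) : ℕ := if i < n then f i else 0

theorem truncate_of_lt {n i : ℕ} (h : i < n) (f : ℕ → ℕ) : truncate n f i = f i := if_pos h

theorem truncate_le_sup (n : ℕ) (f : ℕ → ℕ) (i : ℕ) : truncate n f i ≤ (Finset.range n).sup f := by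
  rw [truncate]
  split_ifs with h
  · exact Finset.le_sup (Finset.mem_range.2 h)
  · exact Nat.zero_le _

theorem setOf_gridWalk_congr {w w' : ℕ × ℕ → ℕ × ℕ → ℝ} {s t : ℕ × ℕ}
    (hw : ∀ u v, MStep u v → v.1 ≤ t.1 → v.2 ≤ t.2 → w u v = w' u v) :
    {C | GridWalk w s t C} = {C | GridWalk w' s t C} :=
  Set.ext fun _ => ⟨fun h => h.congr_weight hw,
    fun h => h.congr_weight fun u v hs h1 h2 => (hw u v hs h1 h2).symm⟩

/-- In the DTW lower-bound construction, let `L` be the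
minimum weight of a directed path from `(0,0)` to `(n_r,n_c)` in the directed
grid on `{0,…,n_r}×{0,…,n_c}` with horizontal/vertical arcs of weight `U` and
diagonal arcs `(i,j)→(i+1,j+1)` of weight `d_i·b_j` if `r_i = c_j` and `√U`
otherwise. Then (i) `L < |n_r−n_c|·U + √U` iff
`DTW(P,Q) < |n_r−n_c|·(4U⁵+10U⁴) + U³`; and (ii) when these hold,
`DTW(P,Q) = L − |n_r−n_c|·U + |n_r−n_c|·(4U⁵+10U⁴) + 4·min{n_r,n_c}·U`. -/
theorem stmt7 (nr nc : ℕ) (hnr : 1 ≤ nr) (hnc : 1 ≤ nc)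
    (r d : ℕ → ℕ) (c b : ℕ → ℕ) (hb : ∀ j, b j ≤ 1) (U : ℕ)
    (hU : 100 * nr * nc * (1 + (Finset.range nr).sup d) ^ 2
        * (1 + (Finset.range nr).sup r) ^ 2
        * (1 + (Finset.range nc).sup c) ^ 2 < U) :
    (sInf {t : ℝ | ∃ π : List (ℕ × ℕ), MPath π (0, 0) (nr, nc) ∧
          t = acost (interW r c d b U) π}
        < |(nr : ℝ) - (nc : ℝ)| * (U : ℝ) + Real.sqrt U
      ↔ sInf {t : ℝ | ∃ π : List (ℕ × ℕ), MPath π (1, 1) (20 * nr, 20 * nc) ∧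
          t = vcost (fun v => |Pcur U r d v.1 - Qcur U c b v.2|) π}
        < |(nr : ℝ) - (nc : ℝ)| * (4 * (U : ℝ) ^ 5 + 10 * (U : ℝ) ^ 4) + (U : ℝ) ^ 3) ∧
    (sInf {t : ℝ | ∃ π : List (ℕ × ℕ), MPath π (0, 0) (nr, nc) ∧
          t = acost (interW r c d b U) π}
        < |(nr : ℝ) - (nc : ℝ)| * (U : ℝ) + Real.sqrt U →
      sInf {t : ℝ | ∃ π : List (ℕ × ℕ), MPath π (1, 1) (20 * nr, 20 * nc) ∧
          t = vcost (fun v => |Pcur U r d v.1 - Qcur U c b v.2|) π}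
        = sInf {t : ℝ | ∃ π : List (ℕ × ℕ), MPath π (0, 0) (nr, nc) ∧
            t = acost (interW r c d b U) π}
          - |(nr : ℝ) - (nc : ℝ)| * (U : ℝ)
          + |(nr : ℝ) - (nc : ℝ)| * (4 * (U : ℝ) ^ 5 + 10 * (U : ℝ) ^ 4)
          + 4 * ((min nr nc : ℕ) : ℝ) * (U : ℝ)) := by
  have hpos : ∀ x : ℕ, 1 ≤ (1 + x) ^ 2 := fun x => Nat.one_le_pow _ _ (by omega)
  have hsq : ∀ x : ℕ, 1 + x ≤ (1 + x) ^ 2 := fun x => Nat.le_self_pow two_ne_zero _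
  set D := (Finset.range nr).sup d with hD
  set R := (Finset.range nr).sup r with hR
  set K := (Finset.range nc).sup c with hK
  have hnn : 1 ≤ nr * nc := Nat.mul_pos hnr hnc
  have hDU : 100 * (nr * nc) * (1 + D) ^ 2 < U := by
    refine lt_of_le_of_lt ?_ hU
    calc 100 * (nr * nc) * (1 + D) ^ 2 = 100 * nr * nc * (1 + D) ^ 2 * 1 * 1 := by ring
      _ ≤ _ := Nat.mul_le_mul (Nat.mul_le_mul le_rfl (hpos R)) (hpos K)
  have hRU : 100 * (1 + R) ≤ U := by
    refine le_trans ?_ hU.le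
    calc 100 * (1 + R) = 100 * 1 * 1 * 1 * (1 + R) * 1 := by ring
      _ ≤ _ := by gcongr <;> first | exact hpos _ | exact hsq _
  have hKU : 100 * (1 + K) ≤ U := by
    refine le_trans ?_ hU.le
    calc 100 * (1 + K) = 100 * 1 * 1 * 1 * 1 * (1 + K) := by ring
      _ ≤ _ := by gcongr <;> first | exact hpos _ | exact hsq _
  have hmin : min nr nc * min nr nc ≤ nr * nc := Nat.mul_le_mul (min_le_left _ _) (min_le_right _ _)
  have hinter : {C | GridWalk (interW r c d b U) (0, 0) (nr, nc) C} =
      {C | GridWalk (interW (truncate nr r) (truncate nc c) (truncate nr d) b U) (0, 0) (nr, nc)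
        C} := by
    refine setOf_gridWalk_congr fun u v _ h1 h2 => ?_
    by_cases h : v = (u.1 + 1, u.2 + 1)
    · subst h
      simp only at h1 h2
      simp only [interW, truncate_of_lt (show u.1 < nr by omega),
        truncate_of_lt (show u.2 < nc by omega)]
    · simp only [interW, if_neg h]
  have hwarp : {C | GridWalk (fun _ v => |Pcur U r d v.1 - Qcur U c b v.2|) (1, 1)
        (20 * nr, 20 * nc) C} =
      {C | GridWalk (warpWeight (alphaVal U (truncate nr r) (truncate nr d))
        (betaVal U (truncate nc c) b)) (1, 1) (20 * nr, 20 * nc) C} := by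
    refine setOf_gridWalk_congr fun u v _ h1 h2 => ?_
    simp only at h1 h2
    simp only [warpWeight, blockCurve, Pcur, Qcur, alphaVal, betaVal,
      truncate_of_lt (show (v.1 - 1) / 20 < nr by omega),
      truncate_of_lt (show (v.2 - 1) / 20 < nc by omega)]
  have hstart : |Pcur U r d (1, 1).1 - Qcur U c b (1, 1).2| = 0 := by
    simp [Pcur, Qcur, alphaVal, betaVal]
  rw [setOf_acost_eq, setOf_vcost_eq _ _ _ hstart, hinter, hwarp, add_assoc (_ - _)]
  refine sInf_interW_lt_iff_and_sInf_warp_eq (M := D) hnr hnc (fun i => ?_) (fun i => ?_) (fun j => ?_) hb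
    (truncate_le_sup nr d) ?_ ?_
  · have := truncate_le_sup nr r i
    omega
  · have := truncate_le_sup nr d i
    nlinarith [hsq D]
  · have := truncate_le_sup nc c j
    omega
  · nlinarith [hpos D]
  · nlinarith [hpos D]
end
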